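/- Let T be a simple geodesic triangle in (E,d̄) where E ⊆ ℝ² is closed and simply connected with induced path metric d̄. Let p₁, p₂, p₃ be three distinct points on a single edge A of T lying on a straight line L, with p₂ between p₁ and p₃. If the open segments L₁ (from p₁ to p₂) and L₂ (from p₂ to p₃) are both disjoint from T \ A, then the arc of T from p₁ to p₃ along A coincides with the line segment of L from p₁ to p₃. -/

import Mathlib

open Set

noncomputable def pathLength {X : Type*} [PseudoEMetricSpace X] {x y : X} (c : Path x y) : ENNReal :=
  eVariationOn (fun t : unitInterval => c t) Set.univ

noncomputable def pathEDist {X : Type*} [PseudoEMetricSpace X] (x y : X) : ENNReal :=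
  ⨅ c : Path x y, pathLength c

/-- A unit-speed geodesic segment of the path metric `pathEDist`, parametrized on
`[0, D]`, from `x` to `y`. -/
def IsGeodesicSegment {X : Type*} [MetricSpace X] (γ : ℝ → X) (D : ℝ) (x y : X) : Prop :=
  γ 0 = x ∧ γ D = y ∧
    ∀ s ∈ Set.Icc 0 D, ∀ t ∈ Set.Icc 0 D, pathEDist (γ s) (γ t) = ENNReal.ofReal |s - t|

/-- A simple closed curve: the image of a topological circle under a continuous
injective map. -/
def IsSimpleClosedCurve {M : Type*} [TopologicalSpace M] (s : Set M) : Prop :=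
  ∃ φ : Metric.sphere (0 : EuclideanSpace ℝ (Fin 2)) 1 → M,
    Continuous φ ∧ Function.Injective φ ∧ Set.range φ = s

/-- A simple geodesic triangle in `(E, d̄)`: three vertices `p`, `q`, `r` of `E`, joined
pairwise by geodesic segments of the induced path metric on `E`, whose union is a
simple closed curve in the ambient space `M`. -/
structure SimpleGeodesicTriangle {M : Type*} [MetricSpace M] (E : Set M) where
  p : E
  q : E
  r : E
  σ : ℝ → E
  τ : ℝ → E
  ρ : ℝ → E
  a : ℝ
  b : ℝ
  c : ℝ
  ha : 0 ≤ a
  hb : 0 ≤ b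
  hc : 0 ≤ c
  hσ : IsGeodesicSegment σ a p q
  hτ : IsGeodesicSegment τ b p r
  hρ : IsGeodesicSegment ρ c q r
  simple : IsSimpleClosedCurve
    ((Subtype.val ∘ σ) '' Set.Icc 0 a ∪ (Subtype.val ∘ τ) '' Set.Icc 0 b ∪
      (Subtype.val ∘ ρ) '' Set.Icc 0 c)

namespace SimpleGeodesicTriangle

variable {M : Type*} [MetricSpace M] {E : Set M} (T : SimpleGeodesicTriangle E)

/-- The image of the triangle in the ambient space. -/
def im : Set M :=
  (Subtype.val ∘ T.σ) '' Set.Icc 0 T.a ∪ (Subtype.val ∘ T.τ) '' Set.Icc 0 T.b ∪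
    (Subtype.val ∘ T.ρ) '' Set.Icc 0 T.c

def edgePQ : Set M := (Subtype.val ∘ T.σ) '' Set.Icc 0 T.a
def edgePR : Set M := (Subtype.val ∘ T.τ) '' Set.Icc 0 T.b
def edgeQR : Set M := (Subtype.val ∘ T.ρ) '' Set.Icc 0 T.c

/-- `A` is an edge of the triangle `T`. -/
def IsEdge (A : Set M) : Prop := A = T.edgePQ ∨ A = T.edgePR ∨ A = T.edgeQR

/-- The (Jordan) interior of the simple closed curve `T`: the points of the bounded
complementary component. -/
def interior : Set M :=
  {w | w ∉ T.im ∧ Bornology.IsBounded (connectedComponentIn T.imᶜ w)}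

/-- The (Jordan) exterior of the simple closed curve `T`: the points of the unbounded
complementary component. -/
def exterior : Set M :=
  {w | w ∉ T.im ∧ ¬ Bornology.IsBounded (connectedComponentIn T.imᶜ w)}

end SimpleGeodesicTriangle

theorem exists_continuous_log {X : Type*} [TopologicalSpace X] [SimplyConnectedSpace X]
    [LocallyPathConnectedSpace X] {f : X → ℂ} (hf : Continuous f) (h0 : ∀ x, f x ≠ 0) :
    ∃ g : X → ℂ, Continuous g ∧ ∀ x, Complex.exp (g x) = f x := by
  obtain ⟨x₀⟩ : Nonempty X := inferInstance
  obtain ⟨g, ⟨-, hg⟩, -⟩ := Complex.isCoveringMapOn_exp.existsUnique_continuousMap_lifts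
    ⟨f, hf⟩ (Complex.exp_log (h0 x₀)) h0
  exact ⟨g, g.continuous, fun x => congrFun hg x⟩

theorem IsPreconnected.sub_eq_sub_of_exp_eq {X : Type*} [TopologicalSpace X] {S : Set X}
    (hS : IsPreconnected S) {g₁ g₂ : X → ℂ} (h₁ : ContinuousOn g₁ S) (h₂ : ContinuousOn g₂ S)
    (h : ∀ x ∈ S, Complex.exp (g₁ x) = Complex.exp (g₂ x)) {x y : X} (hx : x ∈ S) (hy : y ∈ S) :
    g₁ x - g₁ y = g₂ x - g₂ y := by
  have key : ∀ z ∈ S, ∃ n : ℤ, g₁ z - g₂ z = n * (2 * Real.pi * Complex.I) := fun z hz => by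
    obtain ⟨n, hn⟩ := Complex.exp_eq_exp_iff_exists_int.1 (h z hz)
    exact ⟨n, by rw [hn]; ring⟩
  have hval : ∀ z ∈ S, ∀ n : ℤ, g₁ z - g₂ z = n * (2 * Real.pi * Complex.I) →
      (g₁ z - g₂ z).im / (2 * Real.pi) = n := fun z _ n hn => by
    rw [hn]
    have : (n * (2 * Real.pi * Complex.I) : ℂ).im = n * (2 * Real.pi) := by simp
    rw [this]
    field_simp
  have hc : ContinuousOn (fun z => (g₁ z - g₂ z).im / (2 * Real.pi)) S := by fun_prop
  have hord := (hS.image _ hc).ordConnected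
  have main : ∀ a ∈ S, ∀ b ∈ S, ∀ n m : ℤ, g₁ a - g₂ a = n * (2 * Real.pi * Complex.I) →
      g₁ b - g₂ b = m * (2 * Real.pi * Complex.I) → ¬ n < m := by
    intro a ha b hb n m hn hm hlt
    have hlt' : (n : ℝ) + 1 ≤ m := by exact_mod_cast hlt
    obtain ⟨c, hcS, hcv⟩ := hord.out (mem_image_of_mem _ ha) (mem_image_of_mem _ hb)
      (show (n : ℝ) + 1 / 2 ∈ _ by
        rw [hval a ha n hn, hval b hb m hm]; constructor <;> linarith)
    obtain ⟨k, hk⟩ := key c hcS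
    simp only [hval c hcS k hk] at hcv
    have h2 : (2 * k : ℝ) = 2 * n + 1 := by linarith
    have h3 : 2 * k = 2 * n + 1 := by exact_mod_cast h2
    omega
  obtain ⟨n, hn⟩ := key x hx
  obtain ⟨m, hm⟩ := key y hy
  have : n = m := le_antisymm (not_lt.1 (main y hy x hx m n hm hn))
    (not_lt.1 (main x hx y hy n m hn hm))
  subst this
  linear_combination hn - hm

/-- `w ↦ w - z` has a continuous logarithm on `K`. -/
def HasLog (K : Set ℂ) (z : ℂ) : Prop :=
  ∃ g : ℂ → ℂ, ContinuousOn g K ∧ ∀ w ∈ K, Complex.exp (g w) = w - z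

/-- The points that `K` separates from infinity, detected by the absence of a logarithm. -/
def enclosed (K : Set ℂ) : Set ℂ := {z | z ∉ K ∧ ¬ HasLog K z}

theorem HasLog.mono {K K' : Set ℂ} {z : ℂ} (h : HasLog K z) (hK : K' ⊆ K) : HasLog K' z := by
  obtain ⟨g, hg, he⟩ := h
  exact ⟨g, hg.mono hK, fun w hw => he w (hK hw)⟩

theorem HasLog.union {K₁ K₂ : Set ℂ} {z : ℂ} (h₁ : HasLog K₁ z) (h₂ : HasLog K₂ z)
    (hc₁ : IsClosed K₁) (hc₂ : IsClosed K₂) (hpre : IsPreconnected (K₁ ∩ K₂)) :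
    HasLog (K₁ ∪ K₂) z := by
  classical
  obtain ⟨g₁, hg₁, he₁⟩ := h₁
  obtain ⟨g₂, hg₂, he₂⟩ := h₂
  obtain ⟨c, hc1, hc⟩ : ∃ c : ℂ, Complex.exp c = 1 ∧ ∀ w ∈ K₁ ∩ K₂, g₁ w = g₂ w + c := by
    rcases (K₁ ∩ K₂).eq_empty_or_nonempty with h | ⟨x, hx⟩
    · exact ⟨0, by simp, by simp [h]⟩
    · refine ⟨g₁ x - g₂ x, ?_, fun w hw => ?_⟩
      · rw [Complex.exp_sub, he₁ x hx.1, he₂ x hx.2, div_self]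
        rw [← he₁ x hx.1]; exact Complex.exp_ne_zero _
      · have := hpre.sub_eq_sub_of_exp_eq (hg₁.mono inter_subset_left)
          (hg₂.mono inter_subset_right)
          (fun y hy => by rw [he₁ y hy.1, he₂ y hy.2]) hw hx
        linear_combination this
  have e1 : EqOn (fun w => if w ∈ K₁ then g₁ w else g₂ w + c) g₁ K₁ := fun w hw => by simp [hw]
  have e2 : EqOn (fun w => if w ∈ K₁ then g₁ w else g₂ w + c) (fun w => g₂ w + c) K₂ :=
    fun w hw => by
      by_cases h : w ∈ K₁
      · simp [h, hc w ⟨h, hw⟩]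
      · simp [h]
  refine ⟨fun w => if w ∈ K₁ then g₁ w else g₂ w + c, ?_, ?_⟩
  · exact (hg₁.congr e1).union_of_isClosed ((hg₂.add continuousOn_const).congr e2) hc₁ hc₂
  · rintro w (hw | hw)
    · rw [e1 hw, he₁ w hw]
    · rw [e2 hw]; simp only [Complex.exp_add, hc1, he₂ w hw, mul_one]

theorem HasLog.of_near {K : Set ℂ} {z z' : ℂ} (h : HasLog K z)
    (hz : ∀ w ∈ K, ‖z' - z‖ < ‖w - z‖) : HasLog K z' := by
  obtain ⟨g, hg, he⟩ := h
  have hne : ∀ w ∈ K, w - z ≠ 0 := fun w hw h0 => by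
    have := hz w hw
    rw [h0, norm_zero] at this
    exact absurd this (not_lt.2 (norm_nonneg _))
  have hball : ∀ w ∈ K, (w - z') / (w - z) ∈ Complex.slitPlane := fun w hw => by
    apply Complex.ball_one_subset_slitPlane
    rw [Metric.mem_ball, dist_eq_norm]
    have : (w - z') / (w - z) - 1 = (z - z') / (w - z) := by
      field_simp [hne w hw]; ring
    rw [this, norm_div, norm_sub_rev z z', div_lt_one (norm_pos_iff.2 (hne w hw))]
    exact hz w hw
  refine ⟨fun w => g w + Complex.log ((w - z') / (w - z)), ?_, fun w hw => ?_⟩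
  · refine hg.add (ContinuousOn.clog ?_ hball)
    exact ContinuousOn.div (by fun_prop) (by fun_prop) hne
  · rw [Complex.exp_add, he w hw, Complex.exp_log (Complex.slitPlane_ne_zero (hball w hw)),
      mul_div_cancel₀ _ (hne w hw)]

theorem hasLog_of_norm_lt {K : Set ℂ} {z : ℂ} (h : ∀ w ∈ K, ‖w‖ < ‖z‖) : HasLog K z := by
  rcases K.eq_empty_or_nonempty with rfl | ⟨w₀, hw₀⟩
  · exact ⟨0, by simp, by simp⟩
  have hz : z ≠ 0 := norm_pos_iff.1 ((norm_nonneg _).trans_lt (h w₀ hw₀))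
  have hball : ∀ w ∈ K, 1 - w / z ∈ Complex.slitPlane := fun w hw => by
    apply Complex.ball_one_subset_slitPlane
    rw [Metric.mem_ball, dist_eq_norm]
    have : 1 - w / z - 1 = -(w / z) := by ring
    rw [this, norm_neg, norm_div, div_lt_one (norm_pos_iff.2 hz)]
    exact h w hw
  refine ⟨fun w => Complex.log (-z) + Complex.log (1 - w / z), ?_, fun w hw => ?_⟩
  · exact continuousOn_const.add (ContinuousOn.clog (by fun_prop) hball)
  · rw [Complex.exp_add, Complex.exp_log (neg_ne_zero.2 hz),
      Complex.exp_log (Complex.slitPlane_ne_zero (hball w hw))]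
    field_simp
    ring

theorem exists_ball_hasLog_iff {K : Set ℂ} (hK : IsClosed K) {z : ℂ} (hz : z ∉ K) :
    ∃ ε > 0, ∀ z' ∈ Metric.ball z ε, z' ∉ K ∧ (HasLog K z' ↔ HasLog K z) := by
  obtain ⟨ε, hε, hb⟩ := Metric.isOpen_iff.1 hK.isOpen_compl z hz
  have hfar : ∀ w ∈ K, ε ≤ ‖w - z‖ := fun w hw => by
    by_contra! hlt
    exact hb (by rwa [Metric.mem_ball, dist_eq_norm]) hw
  refine ⟨ε / 2, by positivity, fun z' hz' => ?_⟩
  rw [Metric.mem_ball, dist_eq_norm] at hz'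
  have hfar' : ∀ w ∈ K, ε / 2 < ‖w - z'‖ := fun w hw => by
    have h1 := hfar w hw
    have h2 := norm_sub_le_norm_sub_add_norm_sub w z' z
    linarith
  refine ⟨fun h => ?_, fun h => h.of_near fun w hw => ?_, fun h => h.of_near fun w hw => ?_⟩
  · have := hfar' z' h
    rw [sub_self, norm_zero] at this
    linarith
  · rw [norm_sub_rev]; exact hz'.trans (hfar' w hw)
  · linarith [hfar w hw]

theorem isOpen_enclosed {K : Set ℂ} (hK : IsClosed K) : IsOpen (enclosed K) := by
  refine Metric.isOpen_iff.2 fun z hz => ?_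
  obtain ⟨ε, hε, h⟩ := exists_ball_hasLog_iff hK hz.1
  exact ⟨ε, hε, fun z' hz' => ⟨(h z' hz').1, fun h' => hz.2 ((h z' hz').2.1 h')⟩⟩

theorem IsPreconnected.subset_enclosed {S K : Set ℂ} (hS : IsPreconnected S) (hK : IsClosed K)
    (hd : Disjoint S K) (hne : (S ∩ enclosed K).Nonempty) : S ⊆ enclosed K := by
  refine hS.subset_left_of_subset_union (v := {z | z ∉ K ∧ HasLog K z})
    (isOpen_enclosed hK) ?_ ?_ ?_ hne
  · refine Metric.isOpen_iff.2 fun z hz => ?_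
    obtain ⟨ε, hε, h⟩ := exists_ball_hasLog_iff hK hz.1
    exact ⟨ε, hε, fun z' hz' => ⟨(h z' hz').1, (h z' hz').2.2 hz.2⟩⟩
  · exact Set.disjoint_left.2 fun z h1 h2 => h1.2 h2.2
  · intro z hz
    have := Set.disjoint_left.1 hd hz
    by_cases h : HasLog K z
    · exact Or.inr ⟨this, h⟩
    · exact Or.inl ⟨this, h⟩

theorem isBounded_enclosed {K : Set ℂ} (hK : IsCompact K) :
    Bornology.IsBounded (enclosed K) := by
  obtain ⟨R, hR⟩ := hK.isBounded.exists_norm_le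
  refine (Metric.isBounded_closedBall (x := (0 : ℂ)) (r := R)).subset fun z hz => ?_
  rw [mem_closedBall_zero_iff]
  by_contra! h
  exact hz.2 (hasLog_of_norm_lt fun w hw => (hR w hw).trans_lt h)

theorem frontier_enclosed_subset {K : Set ℂ} (hK : IsClosed K) : frontier (enclosed K) ⊆ K := by
  intro z hz
  by_contra hzK
  rw [(isOpen_enclosed hK).frontier_eq] at hz
  obtain ⟨ε, hε, h⟩ := exists_ball_hasLog_iff hK hzK
  obtain ⟨y, hy, hyz⟩ := Metric.mem_closure_iff.1 hz.1 ε hε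
  have := h y (by rwa [Metric.mem_ball, dist_comm])
  exact hz.2 ⟨hzK, fun hl => hy.2 (this.2.2 hl)⟩

theorem not_hasLog_sphere {g : ℂ → ℂ} {z : ℂ} {R : ℝ} (hR : 0 < R) (hg : Continuous g)
    (he : ∀ w, ‖w - z‖ = R → Complex.exp (g w) = w - z) : False := by
  have hw : ∀ θ : ℝ, ‖(z + R * Complex.exp (θ * Complex.I)) - z‖ = R := fun θ => by
    simp [Complex.norm_exp_ofReal_mul_I, abs_of_pos hR]
  have := (isPreconnected_univ (α := ℝ)).sub_eq_sub_of_exp_eq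
    (g₁ := fun θ => g (z + R * Complex.exp (θ * Complex.I)))
    (g₂ := fun θ => Complex.log R + θ * Complex.I) (by fun_prop) (by fun_prop)
    (fun θ _ => by
      rw [he _ (hw θ), Complex.exp_add, Complex.exp_log (by exact_mod_cast hR.ne')]; ring)
    (mem_univ (2 * Real.pi)) (mem_univ 0)
  have h2 : Complex.exp (((2 * Real.pi : ℝ) : ℂ) * Complex.I) = 1 := by
    push_cast; exact Complex.exp_two_pi_mul_I
  simp only [h2, Complex.ofReal_zero, zero_mul, Complex.exp_zero, sub_self] at this
  have h3 : (2 * Real.pi : ℝ) * Complex.I = 0 := by linear_combination -this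
  have := congrArg Complex.im h3
  simp [Real.pi_ne_zero] at this

/-- A bounded open set with frontier in `K` consists, off `K`, of points enclosed by `K`. -/
theorem not_hasLog_of_frontier_subset {D K : Set ℂ}
    (hb : Bornology.IsBounded D) (hf : frontier D ⊆ K) {z : ℂ} (hz : z ∈ D) :
    ¬ HasLog K z := by
  classical
  intro h
  obtain ⟨g, hg, he⟩ := h.mono hf
  obtain ⟨G, hG⟩ := ContinuousMap.exists_restrict_eq (isClosed_frontier (s := D))
    ⟨(frontier D).domRestrict g, continuousOn_iff_continuous_domRestrict.1 hg⟩
  have hG' : ∀ w ∈ frontier D, G w = g w := fun w hw => DFunLike.congr_fun hG ⟨w, hw⟩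
  obtain ⟨R, hR0, hR⟩ := hb.subset_ball_lt 0 z
  have hcont : Continuous fun w => if w ∈ D then Complex.exp (G w) else w - z := by
    refine Continuous.if (fun w hw => ?_) (by fun_prop) (by fun_prop)
    rw [hG' w hw, he w hw]
  obtain ⟨L, hL, hLe⟩ := exists_continuous_log hcont (fun w => by
    split_ifs with hw
    · exact Complex.exp_ne_zero _
    · exact sub_ne_zero.2 fun h => hw (h ▸ hz))
  refine not_hasLog_sphere (g := L) (z := z) hR0 hL fun w hw => ?_
  rw [hLe, if_neg]
  intro hwD
  have := hR hwD
  rw [Metric.mem_ball, dist_eq_norm, hw] at this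
  exact this.false

theorem exists_continuousOn_image_comp {Ψ g : ℝ → ℂ} {a b : ℝ} (hΨ : Continuous Ψ)
    (hg : ContinuousOn g (Icc a b))
    (h : ∀ s ∈ Icc a b, ∀ t ∈ Icc a b, Ψ s = Ψ t → g s = g t) :
    ∃ f : ℂ → ℂ, ContinuousOn f (Ψ '' Icc a b) ∧ ∀ s ∈ Icc a b, f (Ψ s) = g s := by
  have hf : ∀ s ∈ Icc a b, g (Function.invFunOn Ψ (Icc a b) (Ψ s)) = g s := fun s hs =>
    h _ (Function.invFunOn_mem ⟨s, hs, rfl⟩) _ hs (Function.invFunOn_eq ⟨s, hs, rfl⟩)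
  refine ⟨fun w => g (Function.invFunOn Ψ (Icc a b) w), ?_, hf⟩
  let q : Icc a b → Ψ '' Icc a b := fun s => ⟨Ψ s, s, s.2, rfl⟩
  have hq : Continuous q := by fun_prop
  have hq' : Topology.IsQuotientMap q := hq.isClosedMap.isQuotientMap hq (by
    rintro ⟨_, s, hs, rfl⟩; exact ⟨⟨s, hs⟩, rfl⟩)
  rw [continuousOn_iff_continuous_domRestrict, hq'.continuous_iff]
  have : (Icc a b).domRestrict g = (Ψ '' Icc a b).domRestrict
      (fun w => g (Function.invFunOn Ψ (Icc a b) w)) ∘ q := by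
    ext1 s
    exact (hf s s.2).symm
  rw [← this]
  exact continuousOn_iff_continuous_domRestrict.1 hg

theorem hasLog_image_Icc {Ψ g : ℝ → ℂ} {a b : ℝ} {z : ℂ} (hΨ : Continuous Ψ)
    (hg : ContinuousOn g (Icc a b)) (he : ∀ s ∈ Icc a b, Complex.exp (g s) = Ψ s - z)
    (h : ∀ s ∈ Icc a b, ∀ t ∈ Icc a b, Ψ s = Ψ t → g s = g t) :
    HasLog (Ψ '' Icc a b) z := by
  obtain ⟨f, hf, hfg⟩ := exists_continuousOn_image_comp hΨ hg h
  refine ⟨f, hf, ?_⟩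
  rintro _ ⟨s, hs, rfl⟩
  rw [hfg s hs, he s hs]

theorem exists_log_on_Icc {Ψ : ℝ → ℂ} {a b : ℝ} {z : ℂ} (hΨ : Continuous Ψ)
    (hz : z ∉ Ψ '' Icc a b) :
    ∃ g : ℝ → ℂ, ContinuousOn g (Icc a b) ∧ ∀ s ∈ Icc a b, Complex.exp (g s) = Ψ s - z := by
  rcases lt_or_ge b a with hab | hab
  · exact ⟨0, by simp [Icc_eq_empty hab.not_ge], by simp [Icc_eq_empty hab.not_ge]⟩
  obtain ⟨g, hg, he⟩ := exists_continuous_log (f := fun s => Ψ (projIcc a b hab s) - z)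
    (by fun_prop) (fun s h0 => hz ⟨projIcc a b hab s, (projIcc a b hab s).2, sub_eq_zero.1 h0⟩)
  exact ⟨g, hg.continuousOn, fun s hs => by rw [he, projIcc_of_mem hab hs]⟩

theorem hasLog_arc {Ψ : ℝ → ℂ} {a b : ℝ} {z : ℂ} (hΨ : Continuous Ψ)
    (hinj : InjOn Ψ (Icc a b)) (hz : z ∉ Ψ '' Icc a b) : HasLog (Ψ '' Icc a b) z := by
  obtain ⟨g, hg, he⟩ := exists_log_on_Icc hΨ hz
  exact hasLog_image_Icc hΨ hg he fun s hs t ht hst => by rw [hinj hs ht hst]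

theorem hasLog_segment {a b z : ℂ} (hz : z ∉ segment ℝ a b) : HasLog (segment ℝ a b) z := by
  have hΨ : Continuous fun t : ℝ => AffineMap.lineMap (k := ℝ) a b t :=
    AffineMap.lineMap_continuous
  rw [segment_eq_image_lineMap] at hz ⊢
  by_cases hab : a = b
  · subst hab
    obtain ⟨g, hg, he⟩ := exists_log_on_Icc hΨ hz
    have h01 : (0 : ℝ) ∈ Icc (0 : ℝ) 1 := by simp
    refine hasLog_image_Icc hΨ (g := fun _ => g 0) (by fun_prop) (fun s hs => ?_) (by simp)
    have := he 0 h01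
    simpa using this
  · exact hasLog_arc hΨ (AffineMap.lineMap_injective ℝ hab).injOn hz

theorem Complex.pi_div_two_lt_arg_sub_arg {r δ : ℝ} (hδ : 0 < δ) (h : δ * 4 ≤ r) :
    Real.pi / 2 < arg (-r + δ * I) - arg (r + δ * I) := by
  have hr : 0 < r := by linarith
  have h1 : arg (r + δ * I) = Real.arcsin (δ / ‖(r + δ * I : ℂ)‖) := by
    rw [arg_of_re_nonneg (by simp [hr.le])]; simp
  have h2 : arg (-r + δ * I) = Real.arcsin (-δ / ‖(-r + δ * I : ℂ)‖) + Real.pi := by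
    rw [arg_of_re_neg_of_im_nonneg (by simp [hr]) (by simp [hδ.le])]; simp
  have h3 : ‖(-r + δ * I : ℂ)‖ = ‖(r + δ * I : ℂ)‖ := by
    rw [← ofReal_neg, norm_add_mul_I, norm_add_mul_I]; simp
  have h4 : r ≤ ‖(r + δ * I : ℂ)‖ := by
    have := abs_re_le_norm (r + δ * I : ℂ)
    simpa [abs_of_pos hr] using this
  have h5 : δ / ‖(r + δ * I : ℂ)‖ < Real.sin (Real.pi / 4) := by
    rw [Real.sin_pi_div_four, div_lt_iff₀ (by linarith)]
    have : (1 : ℝ) < √2 := by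
      rw [Real.lt_sqrt] <;> norm_num
    nlinarith
  have h6 : Real.arcsin (δ / ‖(r + δ * I : ℂ)‖) < Real.pi / 4 := by
    rwa [Real.arcsin_lt_iff_lt_sin' ⟨by linarith [Real.pi_pos], by linarith [Real.pi_pos]⟩]
  rw [h1, h2, h3, neg_div, Real.arcsin_neg]
  linarith

theorem nonempty_enclosed_union_segment {α : Set ℂ} (hα : IsCompact α) (hc : IsPreconnected α)
    {w : ℂ} {r : ℝ} (hr : 0 < r) (h₁ : w - r ∈ α) (h₂ : w + r ∈ α) (hw : w ∉ α) :
    (enclosed (α ∪ segment ℝ (w - r) (w + r))).Nonempty := by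
  by_contra hemp
  rw [not_nonempty_iff_eq_empty] at hemp
  set K := α ∪ segment ℝ (w - r) (w + r) with hK
  have hlog : ∀ z ∉ K, HasLog K z := fun z hz => by
    by_contra h
    exact (hemp ▸ (⟨hz, h⟩ : z ∈ enclosed K) : z ∈ (∅ : Set ℂ))
  have hd : 0 < Metric.infDist w α := (hα.isClosed.notMem_iff_infDist_pos ⟨_, h₁⟩).1 hw
  obtain ⟨δ, hδ⟩ : ∃ δ, δ * 4 = Metric.infDist w α := ⟨_, div_mul_cancel₀ _ (by norm_num)⟩
  have hδ0 : 0 < δ := by linarith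
  have hfar : ∀ y ∈ α, δ * 4 ≤ ‖y - w‖ := fun y hy => by
    rw [hδ, ← dist_eq_norm, dist_comm]; exact Metric.infDist_le_dist_of_mem hy
  have hδr : δ * 4 ≤ r := by
    simpa [abs_of_pos hr] using hfar _ h₂
  have himseg : ∀ y ∈ segment ℝ (w - r) (w + r), y.im = w.im := by
    rintro y ⟨a, b, -, -, hab, rfl⟩
    simp only [Complex.real_smul, Complex.add_im, Complex.im_ofReal_mul,
      Complex.sub_im, Complex.ofReal_im]
    linear_combination w.im * hab
  have hnot : ∀ s : ℝ, |s| = δ → w + s * Complex.I ∉ K := fun s hs hmem => by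
    rcases hmem with hm | hm
    · have := hfar _ hm
      simp [hs] at this
      linarith
    · have := himseg _ hm
      simp at this
      rw [this, abs_zero] at hs
      linarith
  have hn₁ := hnot δ (abs_of_pos hδ0)
  have hn₂ := hnot (-δ) (by rw [abs_neg, abs_of_pos hδ0])
  obtain ⟨g₁, hg₁, he₁⟩ := hlog _ hn₁
  obtain ⟨g₂, hg₂, he₂⟩ := hlog _ hn₂
  set z₁ := w + δ * Complex.I with hz₁
  set z₂ := w + (-δ : ℝ) * Complex.I with hz₂
  have hsub₂ : ∀ y ∈ K, y - z₂ ≠ 0 := fun y hy h0 => hn₂ (sub_eq_zero.1 h0 ▸ hy)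
  have hre : ∀ y ∈ α, 0 < ((y - z₁) / (y - z₂)).re := fun y hy => by
    have h3 : δ * 3 ≤ ‖y - z₂‖ := by
      have h4 := hfar y hy
      have h5 := norm_sub_le_norm_sub_add_norm_sub y z₂ w
      have h6 : ‖z₂ - w‖ = δ := by simp [hz₂, abs_of_pos hδ0]
      linarith
    have h7 : (y - z₁) / (y - z₂) - 1 = (-2 * δ : ℝ) * Complex.I / (y - z₂) := by
      rw [div_sub_one (hsub₂ y (Or.inl hy))]
      congr 1
      rw [hz₁, hz₂]; push_cast; ring
    have h8 : ‖(y - z₁) / (y - z₂) - 1‖ < 1 := by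
      rw [h7, norm_div, div_lt_one (by linarith)]
      simp [abs_of_pos hδ0]
      linarith
    have h9 := (Complex.abs_re_le_norm _).trans_lt h8
    have := (abs_lt.1 h9).1
    simp at this ⊢
    linarith
  have hcα := hc.sub_eq_sub_of_exp_eq (g₁ := fun y => g₁ y - g₂ y)
    (g₂ := fun y => Complex.log ((y - z₁) / (y - z₂)))
    ((hg₁.mono subset_union_left).sub (hg₂.mono subset_union_left))
    (ContinuousOn.clog (ContinuousOn.div (by fun_prop) (by fun_prop)
      fun y hy => hsub₂ y (Or.inl hy)) fun y hy => Or.inl (hre y hy))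
    (fun y hy => by
      rw [Complex.exp_log, Complex.exp_sub, he₁ _ (Or.inl hy), he₂ _ (Or.inl hy)]
      intro h0
      have := hre y hy
      rw [h0] at this
      simp at this)
    h₂ h₁
  have hseg : ∀ x ∈ Icc (-r) r, w + (x : ℂ) ∈ K := fun x hx => Or.inr (by
    refine ⟨(r - x) / (2 * r), (r + x) / (2 * r), ?_, ?_, ?_, ?_⟩
    · exact div_nonneg (by linarith [hx.2]) (by linarith)
    · exact div_nonneg (by linarith [hx.1]) (by linarith)
    · field_simp; ring
    · have : (r : ℂ) ≠ 0 := by exact_mod_cast hr.ne'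
      simp only [Complex.real_smul]; push_cast; field_simp; ring)
  have hmaps : MapsTo (fun x : ℝ => w + (x : ℂ)) (Icc (-r) r) K := hseg
  have hcs := (isPreconnected_Icc (a := -r) (b := r)).sub_eq_sub_of_exp_eq
    (g₁ := fun x : ℝ => g₁ (w + x) - g₂ (w + x))
    (g₂ := fun x : ℝ => Complex.log (x + (-δ : ℝ) * Complex.I) - Complex.log (x + δ * Complex.I))
    ((hg₁.comp (by fun_prop) hmaps).sub (hg₂.comp (by fun_prop) hmaps))
    ((ContinuousOn.clog (by fun_prop) fun x _ => Or.inr (by simp [hδ0.ne'])).sub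
      (ContinuousOn.clog (by fun_prop) fun x _ => Or.inr (by simp [hδ0.ne'])))
    (fun x hx => by
      have ne : ∀ s : ℝ, s ≠ 0 → (x + s * Complex.I : ℂ) ≠ 0 := fun s hs h0 => hs (by
        simpa using congrArg Complex.im h0)
      rw [Complex.exp_sub, Complex.exp_sub, he₁ _ (hseg x hx), he₂ _ (hseg x hx),
        Complex.exp_log (ne _ hδ0.ne'), Complex.exp_log (ne _ (neg_ne_zero.2 hδ0.ne')), hz₁, hz₂]
      congr 1 <;> push_cast <;> ring)
    (show r ∈ Icc (-r) r by constructor <;> linarith)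
    (show -r ∈ Icc (-r) r by constructor <;> linarith)
  simp only [Complex.ofReal_neg, ← sub_eq_add_neg] at hcs
  rw [hcα] at hcs
  have him := congrArg Complex.im hcs
  simp only [Complex.sub_im, Complex.log_im] at him
  have hb : ∀ y ∈ α, |((y - z₁) / (y - z₂)).arg| < Real.pi / 2 := fun y hy =>
    Complex.abs_arg_lt_pi_div_two_iff.2 (Or.inl (hre y hy))
  have hb₁ := abs_lt.1 (hb _ h₁)
  have hb₂ := abs_lt.1 (hb _ h₂)
  have hconj : ∀ x : ℝ, (x + -δ * Complex.I : ℂ) = (starRingEnd ℂ) (x + δ * Complex.I) :=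
    fun x => by simp
  have hne_pi : ∀ x : ℝ, (x + δ * Complex.I : ℂ).arg ≠ Real.pi := fun x h => by
    have := (Complex.arg_eq_pi_iff.1 h).2
    simp at this
    linarith
  have hc₁ : (r + -δ * Complex.I : ℂ).arg = - (r + δ * Complex.I : ℂ).arg := by
    rw [hconj, Complex.arg_conj, if_neg (hne_pi r)]
  have hc₂ : (-r + -δ * Complex.I : ℂ).arg = - (-r + δ * Complex.I : ℂ).arg := by
    have := hconj (-r)
    push_cast at this
    have h' := hne_pi (-r)
    push_cast at h'
    rw [this]
    have h'' := Complex.arg_conj (-r + δ * Complex.I)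
    rw [if_neg h'] at h''
    rw [← h'']
  have hkey := Complex.pi_div_two_lt_arg_sub_arg hδ0 hδr
  rw [hc₁, hc₂] at him
  linarith

/-- A `2π`-periodic parametrization of a simple closed curve. -/
structure IsLoop {X : Type*} [TopologicalSpace X] (Ψ : ℝ → X) : Prop where
  continuous : Continuous Ψ
  periodic : Function.Periodic Ψ (2 * Real.pi)
  exists_int : ∀ x y, Ψ x = Ψ y → ∃ n : ℤ, x - y = n * (2 * Real.pi)

namespace IsLoop

section

variable {X : Type*} [TopologicalSpace X] {Ψ : ℝ → X}

theorem comp {Y : Type*} [TopologicalSpace Y] (h : IsLoop Ψ) {f : X → Y} (hf : Continuous f)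
    (hf' : Function.Injective f) : IsLoop (f ∘ Ψ) where
  continuous := hf.comp h.continuous
  periodic x := congrArg f (h.periodic x)
  exists_int x y hxy := h.exists_int x y (hf' hxy)

theorem comp_neg (h : IsLoop Ψ) : IsLoop fun x => Ψ (-x) where
  continuous := h.continuous.comp continuous_neg
  periodic x := by
    have := h.periodic.neg (-x)
    simp only [neg_add]
    exact this
  exists_int x y hxy := by
    obtain ⟨n, hn⟩ := h.exists_int _ _ hxy
    exact ⟨-n, by push_cast; linarith⟩

theorem eq_of_abs_sub_lt (h : IsLoop Ψ) {x y : ℝ} (hxy : Ψ x = Ψ y) (hlt : |x - y| < 2 * Real.pi) :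
    x = y := by
  obtain ⟨n, hn⟩ := h.exists_int x y hxy
  have hpi := Real.two_pi_pos
  rw [hn, abs_mul, abs_of_pos hpi, mul_lt_iff_lt_one_left hpi] at hlt
  have : |n| < 1 := by exact_mod_cast hlt
  rw [Int.abs_lt_one_iff.1 this] at hn
  simp at hn
  linarith

theorem injOn_Icc (h : IsLoop Ψ) {a b : ℝ} (hab : b < a + 2 * Real.pi) : InjOn Ψ (Icc a b) :=
  fun x hx y hy hxy => h.eq_of_abs_sub_lt hxy (by
    rw [abs_lt]; constructor <;> linarith [hx.1, hx.2, hy.1, hy.2])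

theorem range_eq_image_Icc (h : IsLoop Ψ) (a : ℝ) : range Ψ = Ψ '' Icc a (a + 2 * Real.pi) :=
  (h.periodic.image_Icc Real.two_pi_pos a).symm

theorem union_arcs (h : IsLoop Ψ) {a b : ℝ} (hab : a ≤ b) (hb : b ≤ a + 2 * Real.pi) :
    Ψ '' Icc a b ∪ Ψ '' Icc b (a + 2 * Real.pi) = range Ψ := by
  rw [← image_union, Icc_union_Icc_eq_Icc hab hb, h.range_eq_image_Icc a]

theorem inter_arcs (h : IsLoop Ψ) {a b : ℝ} :
    Ψ '' Icc a b ∩ Ψ '' Icc b (a + 2 * Real.pi) ⊆ {Ψ a, Ψ b} := by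
  rintro _ ⟨⟨x, hx, rfl⟩, y, hy, hxy⟩
  rcases eq_or_ne x a with rfl | hxa
  · simp
  · have hxa' := lt_of_le_of_ne hx.1 hxa.symm
    have := h.eq_of_abs_sub_lt hxy (by
      rw [abs_lt]; constructor <;> linarith [hx.1, hx.2, hy.1, hy.2])
    subst this
    rw [le_antisymm hx.2 hy.1]
    simp

theorem exists_mem_Ico (h : IsLoop Ψ) (a x : ℝ) : ∃ y ∈ Ico a (a + 2 * Real.pi), Ψ y = Ψ x := by
  obtain ⟨y, hy, hxy⟩ := h.periodic.exists_mem_Ico Real.two_pi_pos x a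
  exact ⟨y, hy, hxy.symm⟩

theorem isCompact_range (h : IsLoop Ψ) : IsCompact (range Ψ) := by
  rw [h.range_eq_image_Icc 0]; exact isCompact_Icc.image h.continuous

theorem isPreconnected_meets [T2Space X] (h : IsLoop Ψ) {a b : ℝ} (hab : a ≤ b)
    (hb : b ≤ a + 2 * Real.pi) {S : Set X} (hS : IsPreconnected S) (hST : S ⊆ range Ψ)
    (h₁ : (S ∩ Ψ '' Icc a b).Nonempty) (h₂ : (S ∩ Ψ '' Icc b (a + 2 * Real.pi)).Nonempty) :
    Ψ a ∈ S ∨ Ψ b ∈ S := by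
  obtain ⟨x, hxS, hx⟩ := isPreconnected_closed_iff.1 hS _ _
    (isCompact_Icc.image h.continuous).isClosed (isCompact_Icc.image h.continuous).isClosed
    (hST.trans (h.union_arcs hab hb).ge) h₁ h₂
  rcases h.inter_arcs hx with rfl | rfl
  · exact Or.inl hxS
  · exact Or.inr hxS

end

variable {Ψ : ℝ → ℂ}

theorem isClosed_arc (h : IsLoop Ψ) (a b : ℝ) : IsClosed (Ψ '' Icc a b) :=
  (isCompact_Icc.image h.continuous).isClosed

theorem isPreconnected_arc (h : IsLoop Ψ) (a b : ℝ) : IsPreconnected (Ψ '' Icc a b) :=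
  isPreconnected_Icc.image _ h.continuous.continuousOn

theorem hasLog_arc (h : IsLoop Ψ) {a b : ℝ} {z : ℂ} (hab : b < a + 2 * Real.pi)
    (hz : z ∉ Ψ '' Icc a b) : HasLog (Ψ '' Icc a b) z :=
  _root_.hasLog_arc h.continuous (h.injOn_Icc hab) hz

end IsLoop

theorem mem_closure_enclosed {K : Set ℂ} (hK : IsCompact K) {e : ℂ}
    (h : ∀ U, IsOpen U → e ∈ U → ∃ K', K \ U ⊆ K' ∧ ∀ z ∉ K, HasLog K' z)
    (hne : (enclosed K).Nonempty) : e ∈ closure (enclosed K) := by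
  by_contra he
  obtain ⟨K', hK', hlog⟩ := h (closure (enclosed K))ᶜ isClosed_closure.isOpen_compl he
  obtain ⟨z, hz⟩ := hne
  refine not_hasLog_of_frontier_subset (isBounded_enclosed hK) (fun w hw => hK' ?_) hz
    (hlog z hz.1)
  exact ⟨frontier_enclosed_subset hK.isClosed hw, fun hn => hn (frontier_subset_closure hw)⟩

theorem Continuous.exists_Icc_subset_preimage {X : Type*} [TopologicalSpace X] {Ψ : ℝ → X}
    (hΨ : Continuous Ψ) {U : Set X} (hU : IsOpen U) {s : ℝ} (hs : Ψ s ∈ U) {r : ℝ} (hr : 0 < r) :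
    ∃ ε > 0, ε < r ∧ ∀ x, |x - s| < ε → Ψ x ∈ U := by
  obtain ⟨ε, hε, h⟩ := Metric.isOpen_iff.1 (hU.preimage hΨ) s hs
  refine ⟨min ε (r / 2), by positivity, (min_le_right _ _).trans_lt (by linarith), fun x hx => ?_⟩
  exact h (by rw [Metric.mem_ball, Real.dist_eq]; exact hx.trans_le (min_le_left _ _))

namespace IsLoop

variable {Ψ : ℝ → ℂ}

theorem range_subset_closure_enclosed (h : IsLoop Ψ) (hne : (enclosed (range Ψ)).Nonempty) :
    range Ψ ⊆ closure (enclosed (range Ψ)) := by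
  rintro _ ⟨s, rfl⟩
  refine mem_closure_enclosed h.isCompact_range (fun U hU hs => ?_) hne
  obtain ⟨ε, hε, hεp, hεU⟩ := h.continuous.exists_Icc_subset_preimage hU hs Real.pi_pos
  refine ⟨Ψ '' Icc (s + ε) (s + 2 * Real.pi - ε), ?_, fun z hz =>
    h.hasLog_arc (by linarith) fun hz' => hz (image_subset_range _ _ hz')⟩
  rintro _ ⟨⟨x, rfl⟩, hx⟩
  obtain ⟨y, hy, hxy⟩ := h.exists_mem_Ico (s - ε) x
  rw [← hxy] at hx ⊢
  by_cases h1 : s + ε ≤ y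
  · exact ⟨y, ⟨h1, by linarith [hy.2]⟩, rfl⟩
  · rcases eq_or_lt_of_le hy.1 with h2 | h2
    · refine ⟨y + 2 * Real.pi, ⟨by linarith [Real.pi_pos], by linarith⟩, h.periodic y⟩
    · exact absurd (hεU y (by rw [abs_lt]; constructor <;> linarith)) hx

end IsLoop

theorem Complex.im_eq_of_mem_segment {a b w : ℂ} (hab : a.im = b.im) (hw : w ∈ segment ℝ a b) :
    w.im = a.im := by
  obtain ⟨p, q, -, -, hpq, rfl⟩ := hw
  simp only [Complex.real_smul, Complex.add_im, Complex.im_ofReal_mul, ← hab]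
  linear_combination a.im * hpq

theorem segment_eq_insert_openSegment {F : Type*} [AddCommGroup F] [Module ℝ F] (a b : F) :
    segment ℝ a b = {a, b} ∪ openSegment ℝ a b := by
  rw [← insert_endpoints_openSegment, insert_union, singleton_union]

theorem isPreconnected_segment {a b : ℂ} : IsPreconnected (segment ℝ a b) :=
  (convex_segment a b).isPreconnected

theorem isCompact_segment {a b : ℂ} : IsCompact (segment ℝ a b) := by
  rw [segment_eq_image_lineMap]
  exact isCompact_Icc.image AffineMap.lineMap_continuous

theorem nonempty_enclosed_union_segment_of_im_eq {α : Set ℂ} (hα : IsCompact α)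
    (hc : IsPreconnected α) {a b : ℂ} (ha : a ∈ α) (hb : b ∈ α) (him : a.im = b.im) (hab : a ≠ b)
    (hm : Disjoint (openSegment ℝ a b) α) : (enclosed (α ∪ segment ℝ a b)).Nonempty := by
  wlog hlt : a.re < b.re generalizing a b
  · rw [segment_symm]
    refine this hb ha him.symm hab.symm (by rwa [openSegment_symm]) ?_
    exact lt_of_le_of_ne (not_lt.1 hlt) fun h => hab (Complex.ext h.symm him)
  have h1 : (a + b) / 2 - ((b.re - a.re) / 2 : ℝ) = a := by
    apply Complex.ext
    · simp; ring
    · simp [him]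
  have h2 : (a + b) / 2 + ((b.re - a.re) / 2 : ℝ) = b := by
    apply Complex.ext
    · simp; ring
    · simp [him]
  have := nonempty_enclosed_union_segment hα hc (w := (a + b) / 2) (r := (b.re - a.re) / 2)
    (by linarith) (by rwa [h1]) (by rwa [h2]) (disjoint_left.1 hm
      ⟨1 / 2, 1 / 2, by norm_num, by norm_num, by norm_num, by
        simp only [Complex.real_smul]; push_cast; ring⟩)
  rwa [h1, h2] at this

namespace IsLoop

variable {Ψ : ℝ → ℂ}

theorem mem_closure_enclosed_arc_union_segment (h : IsLoop Ψ) {t₁ s t₂ : ℝ} (h₁ : t₁ < s)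
    (h₂ : s < t₂) (h₃ : t₂ < t₁ + 2 * Real.pi)
    (hc : Disjoint (openSegment ℝ (Ψ t₁) (Ψ t₂)) (range Ψ))
    (hne : (enclosed (Ψ '' Icc t₁ t₂ ∪ segment ℝ (Ψ t₁) (Ψ t₂))).Nonempty) :
    Ψ s ∈ closure (enclosed (Ψ '' Icc t₁ t₂ ∪ segment ℝ (Ψ t₁) (Ψ t₂))) := by
  refine mem_closure_enclosed ((isCompact_Icc.image h.continuous).union isCompact_segment)
    (fun U hU hs => ?_) hne
  obtain ⟨ε, hε, hεr, hεU⟩ := h.continuous.exists_Icc_subset_preimage hU hs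
    (r := min (s - t₁) (t₂ - s)) (lt_min (by linarith) (by linarith))
  obtain ⟨hε₁, hε₂⟩ := lt_min_iff.1 hεr
  have hseg : ∀ x, Ψ x ∈ segment ℝ (Ψ t₁) (Ψ t₂) → Ψ x = Ψ t₁ ∨ Ψ x = Ψ t₂ := fun x hx => by
    rw [segment_eq_insert_openSegment] at hx
    rcases hx with hx | hx
    · exact hx
    · exact absurd (mem_range_self x) (disjoint_left.1 hc hx)
  have heq : ∀ x ∈ Icc t₁ t₂, ∀ y ∈ Icc t₁ t₂, Ψ x = Ψ y → x = y := fun x hx y hy =>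
    h.injOn_Icc h₃ hx hy
  have m₁ : t₁ ∈ Icc t₁ t₂ := ⟨le_rfl, by linarith⟩
  have m₂ : t₂ ∈ Icc t₁ t₂ := ⟨by linarith, le_rfl⟩
  refine ⟨(Ψ '' Icc t₁ (s - ε) ∪ segment ℝ (Ψ t₁) (Ψ t₂)) ∪ Ψ '' Icc (s + ε) t₂, ?_, ?_⟩
  · rintro w ⟨⟨x, hx, rfl⟩ | hw, hwU⟩
    · by_cases hx1 : x ≤ s - ε
      · exact Or.inl (Or.inl ⟨x, ⟨hx.1, hx1⟩, rfl⟩)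
      · by_cases hx2 : s + ε ≤ x
        · exact Or.inr ⟨x, ⟨hx2, hx.2⟩, rfl⟩
        · exact absurd (hεU x (by rw [abs_lt]; constructor <;> linarith)) hwU
    · exact Or.inl (Or.inr hw)
  · intro z hz
    have hz1 : z ∉ Ψ '' Icc t₁ t₂ := fun h' => hz (Or.inl h')
    refine HasLog.union (HasLog.union ?_ ?_ (h.isClosed_arc _ _) isCompact_segment.isClosed ?_) ?_
      ((h.isClosed_arc _ _).union isCompact_segment.isClosed) (h.isClosed_arc _ _) ?_
    · exact h.hasLog_arc (by linarith) fun h' => hz1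
        (image_mono (Icc_subset_Icc le_rfl (by linarith)) h')
    · exact hasLog_segment fun h' => hz (Or.inr h')
    · have : Ψ '' Icc t₁ (s - ε) ∩ segment ℝ (Ψ t₁) (Ψ t₂) = {Ψ t₁} := by
        ext w
        constructor
        · rintro ⟨⟨x, hx, rfl⟩, hw⟩
          rcases hseg x hw with h' | h'
          · exact h'
          · have := heq x ⟨hx.1, by linarith [hx.2]⟩ t₂ m₂ h'
            linarith [hx.2]
        · rintro rfl
          exact ⟨⟨t₁, ⟨le_rfl, by linarith⟩, rfl⟩, left_mem_segment ℝ _ _⟩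
      rw [this]
      exact isPreconnected_singleton
    · exact h.hasLog_arc (by linarith) fun h' => hz1
        (image_mono (Icc_subset_Icc (by linarith) le_rfl) h')
    · have : (Ψ '' Icc t₁ (s - ε) ∪ segment ℝ (Ψ t₁) (Ψ t₂)) ∩ Ψ '' Icc (s + ε) t₂ = {Ψ t₂} := by
        ext w
        constructor
        · rintro ⟨⟨y, hy, hxy⟩ | hw, x, hx, rfl⟩
          · have := heq y ⟨hy.1, by linarith [hy.2]⟩ x ⟨by linarith [hx.1], hx.2⟩ hxy
            linarith [hy.2, hx.1]
          · rcases hseg x hw with h' | h'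
            · have := heq x ⟨by linarith [hx.1], hx.2⟩ t₁ m₁ h'
              linarith [hx.1]
            · exact h'
        · rintro rfl
          exact ⟨Or.inr (right_mem_segment ℝ _ _), ⟨t₂, ⟨by linarith, le_rfl⟩, rfl⟩⟩
      rw [this]
      exact isPreconnected_singleton

theorem exists_horizontal_chord (h : IsLoop Ψ) {s₀ s₁ : ℝ} (h₁ : s₀ ≤ s₁)
    (h₂ : s₁ ≤ s₀ + 2 * Real.pi) {m : ℝ} (hm₀ : (Ψ s₀).im < m) (hm₁ : m < (Ψ s₁).im) :
    ∃ x ∈ Ioo s₀ s₁, ∃ y ∈ Ioo s₁ (s₀ + 2 * Real.pi), (Ψ x).im = m ∧ (Ψ y).im = m ∧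
      Disjoint (openSegment ℝ (Ψ x) (Ψ y)) (range Ψ) := by
  have hc : Continuous fun x => (Ψ x).im := Complex.continuous_im.comp h.continuous
  have hm₂ : (Ψ (s₀ + 2 * Real.pi)).im < m := by rwa [h.periodic]
  have hne : ∀ x, (Ψ x).im = m → x ≠ s₀ ∧ x ≠ s₁ ∧ x ≠ s₀ + 2 * Real.pi := fun x hx =>
    ⟨by rintro rfl; linarith, by rintro rfl; linarith, by rintro rfl; linarith⟩
  have cpt : ∀ a b : ℝ, IsCompact (Icc a b ∩ (fun x => (Ψ x).im) ⁻¹' {m}) := fun a b =>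
    isCompact_Icc.inter_right (isClosed_singleton.preimage hc)
  obtain ⟨x₀, hx₀, hx₀m⟩ := intermediate_value_Icc h₁ hc.continuousOn ⟨hm₀.le, hm₁.le⟩
  obtain ⟨y₀, hy₀, hy₀m⟩ := intermediate_value_Icc' h₂ hc.continuousOn ⟨hm₂.le, hm₁.le⟩
  obtain ⟨⟨x, y⟩, ⟨⟨hx, hxm⟩, hy, hym⟩, hmin⟩ := ((cpt s₀ s₁).prod
    (cpt s₁ (s₀ + 2 * Real.pi))).exists_isMinOn ⟨(x₀, y₀), ⟨hx₀, hx₀m⟩, hy₀, hy₀m⟩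
    (f := fun p => dist (Ψ p.1) (Ψ p.2)) (by
      have := h.continuous
      fun_prop)
  simp only [mem_preimage, mem_singleton_iff] at hx hxm hy hym
  have hx' := hne x hxm
  have hy' := hne y hym
  have hxI : x ∈ Ioo s₀ s₁ := ⟨lt_of_le_of_ne hx.1 hx'.1.symm, lt_of_le_of_ne hx.2 hx'.2.1⟩
  have hyI : y ∈ Ioo s₁ (s₀ + 2 * Real.pi) :=
    ⟨lt_of_le_of_ne hy.1 hy'.2.1.symm, lt_of_le_of_ne hy.2 hy'.2.2⟩
  refine ⟨x, hxI, y, hyI, hxm, hym, disjoint_left.2 fun w hw hwT => ?_⟩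
  have him := (Complex.im_eq_of_mem_segment (hxm.trans hym.symm)
    (openSegment_subset_segment ℝ _ _ hw)).trans hxm
  have hxy : Ψ x ≠ Ψ y := fun h' => by
    have := h.eq_of_abs_sub_lt h' (by
      rw [abs_lt]; constructor <;> linarith [hxI.1, hxI.2, hyI.1, hyI.2])
    linarith [hxI.2, hyI.1]
  have hdist : dist (Ψ x) w < dist (Ψ x) (Ψ y) ∧ dist w (Ψ y) < dist (Ψ x) (Ψ y) := by
    rw [openSegment_eq_image_lineMap] at hw
    obtain ⟨t, ht, rfl⟩ := hw
    have hd := dist_pos.2 hxy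
    rw [dist_left_lineMap, dist_lineMap_right, Real.norm_eq_abs, Real.norm_eq_abs,
      abs_of_pos ht.1, abs_of_pos (by linarith [ht.2])]
    constructor <;> nlinarith [ht.1, ht.2]
  rw [← h.union_arcs h₁ h₂] at hwT
  rcases hwT with ⟨u, hu, rfl⟩ | ⟨u, hu, rfl⟩
  · exact absurd (hmin (a := (u, y)) ⟨⟨hu, him⟩, hy, hym⟩) (not_le.2 hdist.2)
  · exact absurd (hmin (a := (x, u)) ⟨⟨hx, hxm⟩, hu, him⟩) (not_le.2 hdist.1)

theorem nonempty_enclosed (h : IsLoop Ψ) {x y : ℝ} (hxy : (Ψ x).im ≠ (Ψ y).im) :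
    (enclosed (range Ψ)).Nonempty := by
  have hc : Continuous fun x => (Ψ x).im := Complex.continuous_im.comp h.continuous
  obtain ⟨e, ⟨s₀, rfl⟩, hs₀⟩ := h.isCompact_range.exists_isMinOn (range_nonempty Ψ)
    Complex.continuous_im.continuousOn
  obtain ⟨_, ⟨s₁', rfl⟩, hs₁'⟩ := h.isCompact_range.exists_isMaxOn (range_nonempty Ψ)
    Complex.continuous_im.continuousOn
  obtain ⟨s₁, hs₁I, hs₁⟩ := h.exists_mem_Ico s₀ s₁'
  rw [← hs₁] at hs₁'
  have hlt : (Ψ s₀).im < (Ψ s₁).im := by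
    by_contra! hle
    have h1 : ∀ z, (Ψ z).im = (Ψ s₀).im := fun z =>
      le_antisymm ((hs₁' (mem_range_self z)).trans hle) (hs₀ (mem_range_self z))
    exact hxy ((h1 x).trans (h1 y).symm)
  obtain ⟨m, hm₀, hm₁⟩ := exists_between hlt
  obtain ⟨a, ha, b, hb, ham, hbm, hdisj⟩ := h.exists_horizontal_chord hs₁I.1 hs₁I.2.le hm₀ hm₁
  have hper : Ψ (a + 2 * Real.pi) = Ψ a := h.periodic a
  have hs₀' : Ψ (s₀ + 2 * Real.pi) = Ψ s₀ := h.periodic s₀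
  rw [openSegment_symm] at hdisj
  have hba : Ψ b ≠ Ψ a := fun h' => by
    have := h.eq_of_abs_sub_lt h' (by
      rw [abs_lt]; constructor <;> linarith [ha.1, ha.2, hb.1, hb.2])
    linarith [ha.2, hb.1]
  have hab : b ≤ a + 2 * Real.pi := by linarith [ha.1, hb.2]
  set c := segment ℝ (Ψ b) (Ψ a) with hcdef
  set α := Ψ '' Icc b (a + 2 * Real.pi) with hα
  set β := Ψ '' Icc a b with hβ
  have hαβ : β ∪ α = range Ψ := h.union_arcs (by linarith [ha.2, hb.1]) hab
  have hne : (enclosed (α ∪ c)).Nonempty := nonempty_enclosed_union_segment_of_im_eq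
    (isCompact_Icc.image h.continuous) (h.isPreconnected_arc _ _)
    ⟨b, ⟨le_rfl, hab⟩, rfl⟩ ⟨a + 2 * Real.pi, ⟨hab, le_rfl⟩, hper⟩
    (hbm.trans ham.symm) hba (hdisj.mono_right (image_subset_range _ _))
  have hcl : Ψ s₀ ∈ closure (enclosed (α ∪ c)) := by
    have := h.mem_closure_enclosed_arc_union_segment (t₁ := b) (s := s₀ + 2 * Real.pi)
      (t₂ := a + 2 * Real.pi) hb.2 (by linarith [ha.1]) (by linarith [ha.2, hb.1])
      (by rwa [hper]) (by rwa [hper])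
    rwa [hper, hs₀'] at this
  have hβc : IsCompact (β ∪ c) := (isCompact_Icc.image h.continuous).union isCompact_segment
  have hcim : ∀ w ∈ c, w.im = m := fun w hw =>
    (Complex.im_eq_of_mem_segment (hbm.trans ham.symm) hw).trans hbm
  have hray : ∀ t : ℝ, 0 ≤ t → Ψ s₀ - t * Complex.I ∉ β ∪ c := by
    rintro t ht (hw | hw)
    · have him : (Ψ s₀).im ≤ (Ψ s₀ - t * Complex.I).im := hs₀ (image_subset_range _ _ hw)
      have ht0 : t = 0 := by simp at him; linarith
      rw [ht0] at hw
      simp only [Complex.ofReal_zero, zero_mul, sub_zero] at hw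
      have hmem : Ψ s₀ ∈ α := ⟨s₀ + 2 * Real.pi, ⟨hb.2.le, by linarith [ha.1]⟩, hs₀'⟩
      rcases h.inter_arcs ⟨hw, hmem⟩ with h' | h'
      · rw [h'] at hm₀; linarith
      · rw [h'] at hm₀; linarith
    · have := hcim _ hw
      simp at this
      linarith
  have hnot : Ψ s₀ ∉ enclosed (β ∪ c) := fun hmem => by
    have hsub := (isPreconnected_Ici (a := (0 : ℝ))).image (fun t : ℝ => Ψ s₀ - t * Complex.I)
      (by fun_prop)
    have hsub' := hsub.subset_enclosed hβc.isClosed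
      (disjoint_left.2 (by rintro _ ⟨t, ht, rfl⟩; exact hray t ht))
      ⟨Ψ s₀, ⟨0, by simp, by simp⟩, hmem⟩
    obtain ⟨R, hR⟩ := (isBounded_enclosed hβc).exists_norm_le
    have h0 : 0 ≤ R := (norm_nonneg _).trans (hR _ hmem)
    have h1 := hR _ (hsub' (mem_image_of_mem _
      (show R + ‖Ψ s₀‖ + 1 ∈ Ici (0 : ℝ) by simp only [mem_Ici]; positivity)))
    have h2 := norm_sub_norm_le (((R + ‖Ψ s₀‖ + 1 : ℝ) : ℂ) * Complex.I) (Ψ s₀)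
    rw [norm_sub_rev, norm_mul, Complex.norm_I, mul_one, Complex.norm_real, Real.norm_eq_abs,
      abs_of_nonneg (by positivity)] at h2
    linarith
  have hs₀n : Ψ s₀ ∉ β ∪ c := by simpa using hray 0 le_rfl
  have hlog : HasLog (β ∪ c) (Ψ s₀) := by
    by_contra h'
    exact hnot ⟨hs₀n, h'⟩
  obtain ⟨ε, hε, hball⟩ := exists_ball_hasLog_iff hβc.isClosed hs₀n
  obtain ⟨z, hz, hzε⟩ := Metric.mem_closure_iff.1 hcl ε hε
  obtain ⟨hz1, hz2⟩ := hball z (by rwa [Metric.mem_ball, dist_comm])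
  refine ⟨z, ?_, fun hT => hz.2 ?_⟩
  · rw [← hαβ]
    rintro (h' | h')
    · exact hz1 (Or.inl h')
    · exact hz.1 (Or.inl h')
  · have hinter : range Ψ ∩ (β ∪ c) = β := by
      refine subset_antisymm ?_ fun w hw => ⟨image_subset_range _ _ hw, Or.inl hw⟩
      rintro w ⟨hw, hw' | hw'⟩
      · exact hw'
      · rw [hcdef, segment_eq_insert_openSegment] at hw'
        have hab' : a ≤ b := by linarith [ha.2, hb.1]
        rcases hw' with (rfl | rfl) | hw'
        · exact ⟨b, ⟨hab', le_rfl⟩, rfl⟩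
        · exact ⟨a, ⟨le_rfl, hab'⟩, rfl⟩
        · exact absurd hw (disjoint_left.1 hdisj hw')
    refine (HasLog.union hT (hz2.2 hlog) h.isCompact_range.isClosed hβc.isClosed ?_).mono ?_
    · rw [hinter]; exact h.isPreconnected_arc _ _
    · exact union_subset_union (image_subset_range _ _) subset_union_right

theorem not_mem_enclosed_arc_union_segment (h : IsLoop Ψ) {t ξ v : ℝ} (h₁ : t < ξ) (h₂ : ξ < v)
    (h₃ : v < t + 2 * Real.pi) (hc : openSegment ℝ (Ψ t) (Ψ ξ) ⊆ enclosed (range Ψ)) {S : Set ℂ}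
    (hS : IsPreconnected S) (hST : S ⊆ enclosed (range Ψ))
    (hSc : Disjoint S (segment ℝ (Ψ t) (Ψ ξ))) (hv : Ψ v ∈ closure S) {z : ℂ} (hz : z ∈ S) :
    z ∉ enclosed (Ψ '' Icc t ξ ∪ segment ℝ (Ψ t) (Ψ ξ)) := by
  intro hzE
  set α := Ψ '' Icc t ξ with hα
  set c := segment ℝ (Ψ t) (Ψ ξ) with hcdef
  have hαc : IsCompact (α ∪ c) := (isCompact_Icc.image h.continuous).union isCompact_segment
  have hmt : Ψ t ∈ α := ⟨t, ⟨le_rfl, h₁.le⟩, rfl⟩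
  have hmξ : Ψ ξ ∈ α := ⟨ξ, ⟨h₁.le, le_rfl⟩, rfl⟩
  have hcα : c ⊆ α ∪ enclosed (range Ψ) := by
    rw [hcdef, segment_eq_insert_openSegment]
    rintro w ((rfl | rfl) | hw)
    · exact Or.inl hmt
    · exact Or.inl hmξ
    · exact Or.inr (hc hw)
  have hβα : ∀ x ∈ Ioo ξ (t + 2 * Real.pi), Ψ x ∉ α := by
    rintro x hx ⟨y, hy, hxy⟩
    have := h.eq_of_abs_sub_lt hxy (by
      rw [abs_lt]; constructor <;> linarith [hx.1, hx.2, hy.1, hy.2])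
    linarith [hx.1, hy.2]
  have hβ : ∀ x ∈ Ioo ξ (t + 2 * Real.pi), Ψ x ∉ α ∪ c := by
    rintro x hx (hw | hw)
    · exact hβα x hx hw
    · rcases hcα hw with hw | hw
      · exact hβα x hx hw
      · exact hw.1 (mem_range_self x)
  have hSα : Disjoint S (α ∪ c) := by
    refine disjoint_left.2 fun w hw => ?_
    rintro (hw' | hw')
    · exact (hST hw).1 (image_subset_range _ _ hw')
    · exact disjoint_left.1 hSc hw hw'
  have hvE : Ψ v ∈ enclosed (α ∪ c) := by
    refine (hS.subset_closure (t := S ∪ {Ψ v}) subset_union_left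
      (union_subset subset_closure (singleton_subset_iff.2 hv))).subset_enclosed hαc.isClosed ?_
      ⟨z, Or.inl hz, hzE⟩ (Or.inr rfl)
    exact hSα.union_left (disjoint_singleton_left.2 (hβ v ⟨h₂, h₃⟩))
  have hβE : Ψ '' Ioo ξ (t + 2 * Real.pi) ⊆ enclosed (α ∪ c) := by
    refine (isPreconnected_Ioo.image _ h.continuous.continuousOn).subset_enclosed hαc.isClosed ?_
      ⟨Ψ v, ⟨v, ⟨h₂, h₃⟩, rfl⟩, hvE⟩
    exact disjoint_left.2 (by rintro _ ⟨x, hx, rfl⟩; exact hβ x hx)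
  have hopen : IsOpen (enclosed (α ∪ c) ∪ enclosed (range Ψ)) :=
    (isOpen_enclosed hαc.isClosed).union (isOpen_enclosed h.isCompact_range.isClosed)
  refine not_hasLog_of_frontier_subset (K := α)
    ((isBounded_enclosed hαc).union (isBounded_enclosed h.isCompact_range)) ?_
    (Or.inr (hST hz)) (h.hasLog_arc (by linarith) fun h' => (hST hz).1 (image_subset_range _ _ h'))
  intro w hw
  have hwn := hw
  rw [hopen.frontier_eq] at hwn
  have hwT : w ∈ (α ∪ c) ∪ range Ψ := by
    rcases frontier_union_subset _ _ hw with hw' | hw'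
    · exact Or.inl (frontier_enclosed_subset hαc.isClosed hw'.1)
    · exact Or.inr (frontier_enclosed_subset h.isCompact_range.isClosed hw'.2)
  rcases hwT with (hw' | hw') | hw'
  · exact hw'
  · rcases hcα hw' with hw' | hw'
    · exact hw'
    · exact absurd (Or.inr hw') hwn.2
  · rw [← h.union_arcs h₁.le (by linarith)] at hw'
    rcases hw' with hw' | ⟨x, hx, rfl⟩
    · exact hw'
    · rcases eq_or_lt_of_le hx.1 with rfl | hx1
      · exact hmξ
      · rcases eq_or_lt_of_le hx.2 with rfl | hx2
        · rw [h.periodic]; exact hmt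
        · exact absurd (Or.inl (hβE ⟨x, ⟨hx1, hx2⟩, rfl⟩)) hwn.2

/-- Inside a simple closed curve, a connected set cannot cross a chord. -/
theorem not_linked (h : IsLoop Ψ) {t u ξ v : ℝ} (h₁ : t < u) (h₂ : u < ξ) (h₃ : ξ < v)
    (h₄ : v < t + 2 * Real.pi) (hc : openSegment ℝ (Ψ t) (Ψ ξ) ⊆ enclosed (range Ψ)) {S : Set ℂ}
    (hS : IsPreconnected S) (hST : S ⊆ enclosed (range Ψ))
    (hSc : Disjoint S (segment ℝ (Ψ t) (Ψ ξ))) (hu : Ψ u ∈ closure S) (hv : Ψ v ∈ closure S) :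
    False := by
  obtain ⟨z, hz⟩ : S.Nonempty := closure_nonempty_iff.1 ⟨_, hu⟩
  have hper : Ψ (t + 2 * Real.pi) = Ψ t := h.periodic t
  have hz1 := h.not_mem_enclosed_arc_union_segment (h₁.trans h₂) h₃ h₄ hc hS hST hSc hv hz
  have hz2 := h.not_mem_enclosed_arc_union_segment (t := ξ) (ξ := t + 2 * Real.pi)
    (v := u + 2 * Real.pi) (by linarith) (by linarith) (by linarith)
    (by rwa [hper, openSegment_symm]) hS hST (by rwa [hper, segment_symm])
    (by rwa [h.periodic]) hz
  rw [hper, segment_symm] at hz2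
  set c := segment ℝ (Ψ t) (Ψ ξ) with hcdef
  have hT : z ∉ range Ψ := (hST hz).1
  have hzc := disjoint_left.1 hSc hz
  have log₁ : HasLog (Ψ '' Icc t ξ ∪ c) z := by
    by_contra h'
    exact hz1 ⟨by rintro (h | h); exacts [hT (image_subset_range _ _ h), hzc h], h'⟩
  have log₂ : HasLog (Ψ '' Icc ξ (t + 2 * Real.pi) ∪ c) z := by
    by_contra h'
    exact hz2 ⟨by rintro (h | h); exacts [hT (image_subset_range _ _ h), hzc h], h'⟩
  refine (hST hz).2 ((HasLog.union log₁ log₂ ((h.isClosed_arc _ _).union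
    isCompact_segment.isClosed) ((h.isClosed_arc _ _).union isCompact_segment.isClosed) ?_).mono ?_)
  · have : (Ψ '' Icc t ξ ∪ c) ∩ (Ψ '' Icc ξ (t + 2 * Real.pi) ∪ c) = c := by
      rw [← inter_union_distrib_right]
      refine union_eq_self_of_subset_left (h.inter_arcs.trans ?_)
      rintro w (rfl | rfl)
      · exact left_mem_segment ℝ _ _
      · exact right_mem_segment ℝ _ _
    rw [this]
    exact isPreconnected_segment
  · rw [← h.union_arcs (h₁.trans h₂).le (by linarith)]
    exact union_subset_union subset_union_left subset_union_left

end IsLoop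

theorem Complex.mem_openSegment_iff_of_im_eq {a b w : ℂ} (him : a.im = b.im) (hab : a ≠ b) :
    w ∈ openSegment ℝ a b ↔ w.im = a.im ∧ w.re ∈ Ioo (min a.re b.re) (max a.re b.re) := by
  have hre : a.re ≠ b.re := fun h => hab (Complex.ext h him)
  rw [← openSegment_eq_Ioo' hre]
  constructor
  · intro hw
    refine ⟨Complex.im_eq_of_mem_segment him (openSegment_subset_segment ℝ _ _ hw), ?_⟩
    obtain ⟨p, q, hp, hq, hpq, rfl⟩ := hw
    exact ⟨p, q, hp, hq, hpq, by simp⟩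
  · rintro ⟨h1, p, q, hp, hq, hpq, h2⟩
    refine ⟨p, q, hp, hq, hpq, Complex.ext ?_ ?_⟩
    · simpa using h2
    · simp [h1, ← him]
      linear_combination a.im * hpq

theorem exists_ray_hit {K : Set ℂ} (hK : IsCompact K) {x v : ℂ} (hx : x ∈ enclosed K)
    (hv : v ≠ 0) :
    ∃ t : ℝ, 0 < t ∧ x + t * v ∈ K ∧ ∀ s ∈ Ico 0 t, x + (s : ℂ) * v ∈ enclosed K := by
  have hc : Continuous fun s : ℝ => x + (s : ℂ) * v := by fun_prop
  have sub : ∀ I : Set ℝ, IsPreconnected I → 0 ∈ I → (∀ s ∈ I, x + (s : ℂ) * v ∉ K) →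
      ∀ s ∈ I, x + (s : ℂ) * v ∈ enclosed K := fun I hI h0 hn s hs =>
    (hI.image _ hc.continuousOn).subset_enclosed hK.isClosed
      (disjoint_left.2 (by rintro _ ⟨s, hs, rfl⟩; exact hn s hs))
      ⟨x, ⟨0, h0, by simp⟩, hx⟩ (mem_image_of_mem _ hs)
  set H := Ici (0 : ℝ) ∩ (fun s : ℝ => x + (s : ℂ) * v) ⁻¹' K with hH
  have hne : H.Nonempty := by
    by_contra hemp
    rw [not_nonempty_iff_eq_empty] at hemp
    have hall := sub (Ici 0) isPreconnected_Ici (by simp) fun s hs h' =>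
      (hemp ▸ (⟨hs, h'⟩ : s ∈ H) : s ∈ (∅ : Set ℝ))
    obtain ⟨R, hR⟩ := (isBounded_enclosed hK).exists_norm_le
    have hv0 := norm_pos_iff.2 hv
    have h0 : 0 ≤ R := (norm_nonneg _).trans (hR _ hx)
    have hs : 0 ≤ (R + ‖x‖ + 1) / ‖v‖ := by positivity
    have h1 := hR _ (hall _ hs)
    have h2 := norm_sub_le_norm_add ((((R + ‖x‖ + 1) / ‖v‖ : ℝ) : ℂ) * v) x
    rw [norm_mul, Complex.norm_real, Real.norm_eq_abs, abs_of_nonneg hs,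
      div_mul_cancel₀ _ hv0.ne', add_comm (_ * v)] at h2
    linarith
  have hcl : IsClosed H := isClosed_Ici.inter (hK.isClosed.preimage hc)
  have hbdd : BddBelow H := ⟨0, fun s hs => hs.1⟩
  have hmem := hcl.csInf_mem hne hbdd
  have hpos : 0 < sInf H := lt_of_le_of_ne hmem.1 fun h => hx.1 (by
    have := hmem.2
    rw [← h] at this
    simpa using this)
  exact ⟨sInf H, hpos, hmem.2, sub (Ico 0 (sInf H)) isPreconnected_Ico ⟨le_rfl, hpos⟩
    fun s hs h' => notMem_of_lt_csInf hs.2 hbdd ⟨hs.1, h'⟩⟩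

namespace IsLoop

variable {Ψ : ℝ → ℂ}

/-- Near a strict local extremum of the height on an arc that admits no chords, the curve
encloses the side that it does not occupy. -/
theorem enclosed_near_extremum (h : IsLoop Ψ) (hne : (enclosed (range Ψ)).Nonempty)
    {α₀ α₁ t : ℝ} (ht : t ∈ Ioo α₀ α₁) (hα : α₁ < α₀ + 2 * Real.pi)
    (hA : ∀ a ∈ Ψ '' Icc α₀ α₁, ∀ b ∈ Ψ '' Icc α₀ α₁,
      segment ℝ a b ⊆ enclosed (range Ψ) ∪ range Ψ → segment ℝ a b ⊆ range Ψ)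
    {ε δ : ℝ} (hε : ε = 1 ∨ ε = -1) (hδ : 0 < δ)
    (hext : ∀ y ∈ range Ψ, ‖y - Ψ t‖ < δ → y ≠ Ψ t → ε * y.im < ε * (Ψ t).im) :
    ∃ ρ > 0, ∀ z, ‖z - Ψ t‖ < ρ → ε * (Ψ t).im ≤ ε * z.im → z ≠ Ψ t →
      z ∈ enclosed (range Ψ) := by
  set T := range Ψ with hT
  set e := Ψ t with he
  have hεε : ε * ε = 1 := by rcases hε with rfl | rfl <;> norm_num
  have heT : e ∈ T := mem_range_self t
  have hTc : IsClosed T := h.isCompact_range.isClosed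
  obtain ⟨ρ, hρ, hρδ, hρA⟩ : ∃ ρ > 0, ρ ≤ δ ∧ ∀ y ∈ T, ‖y - e‖ < ρ → y ∈ Ψ '' Icc α₀ α₁ := by
    have : e ∉ Ψ '' Icc α₁ (α₀ + 2 * Real.pi) := by
      rintro ⟨x, hx, hxe⟩
      have := h.eq_of_abs_sub_lt hxe (by
        rw [abs_lt]; constructor <;> linarith [hx.1, hx.2, ht.1, ht.2])
      linarith [hx.1, ht.2]
    obtain ⟨r, hr, hb⟩ := Metric.isOpen_iff.1 (h.isClosed_arc α₁ (α₀ + 2 * Real.pi)).isOpen_compl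
      e this
    refine ⟨min r δ, by positivity, min_le_right _ _, fun y hy hyr => ?_⟩
    rw [hT, ← h.union_arcs (ht.1.trans ht.2).le hα.le] at hy
    refine hy.resolve_right (hb ?_)
    rw [Metric.mem_ball, dist_eq_norm]
    exact hyr.trans_le (min_le_left _ _)
  have hVT : ∀ z, ‖z - e‖ < ρ → ε * e.im ≤ ε * z.im → z ≠ e → z ∉ T := fun z h1 h2 h3 hz =>
    (hext z hz (h1.trans_le hρδ) h3).not_ge h2
  set V := Metric.ball e ρ ∩ {z : ℂ | ε * e.im < ε * z.im} with hVdef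
  have hVpre : IsPreconnected V := by
    refine ((convex_ball e ρ).inter ?_).isPreconnected
    refine convex_halfSpace_gt (f := fun z : ℂ => ε * z.im) ⟨fun x y => ?_, fun c x => ?_⟩ _
    · simp [mul_add]
    · simp; ring
  have hV : ∀ z, ‖z - e‖ < ρ → ε * e.im ≤ ε * z.im → z ≠ e → ∃ z' ∈ V,
      (z ∈ enclosed T ↔ z' ∈ enclosed T) := by
    intro z h1 h2 h3
    obtain ⟨η, hη, hb⟩ := exists_ball_hasLog_iff hTc (hVT z h1 h2 h3)
    obtain ⟨s, hs0, hs⟩ := exists_between (lt_min hη (sub_pos.2 h1))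
    obtain ⟨hs1, hs2⟩ := lt_min_iff.1 hs
    have hn : ‖((s * ε : ℝ) : ℂ) * Complex.I‖ = s := by
      rw [norm_mul, Complex.norm_I, mul_one, Complex.norm_real, Real.norm_eq_abs, abs_mul,
        abs_of_pos hs0]
      rcases hε with rfl | rfl <;> simp
    refine ⟨z + ((s * ε : ℝ) : ℂ) * Complex.I, ⟨?_, ?_⟩, ?_⟩
    · rw [Metric.mem_ball, dist_eq_norm, add_sub_right_comm]
      exact (norm_add_le _ _).trans_lt (by rw [hn]; linarith)
    · simp only [mem_ofPred_eq, Complex.add_im, Complex.im_ofReal_mul, Complex.I_im]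
      nlinarith
    · obtain ⟨h4, h5⟩ := hb (z + ((s * ε : ℝ) : ℂ) * Complex.I) (by
        rw [Metric.mem_ball, dist_eq_norm, add_sub_cancel_left, hn]; exact hs1)
      exact ⟨fun hz => ⟨h4, fun hl => hz.2 (h5.1 hl)⟩,
        fun hz => ⟨hVT z h1 h2 h3, fun hl => hz.2 (h5.2 hl)⟩⟩
  by_cases hVΩ : (V ∩ enclosed T).Nonempty
  · have hsub := hVpre.subset_enclosed hTc (disjoint_left.2 fun z hz => hVT z
      (by rw [← dist_eq_norm]; exact hz.1) hz.2.le (fun h0 => by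
        have h1 : ε * e.im < ε * z.im := hz.2
        rw [h0] at h1
        exact h1.false)) hVΩ
    refine ⟨ρ, hρ, fun z h1 h2 h3 => ?_⟩
    obtain ⟨z', hz', hiff⟩ := hV z h1 h2 h3
    exact hiff.2 (hsub hz')
  exfalso
  have hΩV : ∀ z ∈ enclosed T, ‖z - e‖ < ρ → ε * z.im < ε * e.im := by
    intro z hz h1
    by_contra! h2
    obtain ⟨z', hz', hiff⟩ := hV z h1 h2 (by rintro rfl; exact hz.1 heT)
    exact hVΩ ⟨z', hz', hiff.1 hz⟩
  obtain ⟨κ, hκ, hκρ, hκN⟩ : ∃ κ > 0, κ ≤ ρ / 12 ∧ ∀ y ∈ T, |(y - e).re| = ρ / 3 →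
      ‖y - e‖ ≤ ρ / 2 → ε * y.im ≤ ε * e.im - κ := by
    have hcpt : IsCompact (T ∩ {y : ℂ | |(y - e).re| = ρ / 3 ∧ ‖y - e‖ ≤ ρ / 2}) := by
      refine h.isCompact_range.inter_right (IsClosed.inter ?_ ?_)
      · exact isClosed_eq (f := fun y : ℂ => |(y - e).re|) (g := fun _ => ρ / 3)
          (by fun_prop) (by fun_prop)
      · exact isClosed_le (f := fun y : ℂ => ‖y - e‖) (g := fun _ => ρ / 2)
          (by fun_prop) (by fun_prop)
    rcases (T ∩ {y : ℂ | |(y - e).re| = ρ / 3 ∧ ‖y - e‖ ≤ ρ / 2}).eq_empty_or_nonempty with h0 | h0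
    · exact ⟨ρ / 12, by positivity, le_rfl, fun y hy h1 h2 =>
        absurd (h0 ▸ (⟨hy, h1, h2⟩ : y ∈ T ∩ {y : ℂ | |(y - e).re| = ρ / 3 ∧ ‖y - e‖ ≤ ρ / 2}))
          (notMem_empty y)⟩
    · obtain ⟨y₀, ⟨hy₀T, hy₀1, hy₀2⟩, hmax⟩ := hcpt.exists_isMaxOn h0
        (f := fun y => ε * y.im) (by fun_prop)
      have hlt := hext y₀ hy₀T (by linarith) (by
        rintro rfl
        rw [sub_self, Complex.zero_re, abs_zero] at hy₀1
        linarith)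
      refine ⟨min (ε * e.im - ε * y₀.im) (ρ / 12), lt_min (by linarith) (by positivity),
        min_le_right _ _, fun y hy h1 h2 => ?_⟩
      have h3 : ε * y.im ≤ ε * y₀.im := hmax ⟨hy, h1, h2⟩
      have h4 := min_le_left (ε * e.im - ε * y₀.im) (ρ / 12)
      linarith
  obtain ⟨x, hx, hxe⟩ := Metric.mem_closure_iff.1 (h.range_subset_closure_enclosed hne heT) κ hκ
  rw [dist_comm, dist_eq_norm] at hxe
  have hxlt := hΩV x hx (by linarith)
  have hxre := (Complex.abs_re_le_norm _).trans_lt hxe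
  have hxim := (Complex.abs_im_le_norm _).trans_lt hxe
  rw [Complex.sub_re] at hxre
  rw [Complex.sub_im] at hxim
  have key : ∀ σ : ℝ, σ = 1 ∨ σ = -1 → ∃ s : ℝ, 0 < s ∧ x + (s : ℂ) * (σ : ℂ) ∈ Ψ '' Icc α₀ α₁ ∧
      ∀ s' ∈ Ico 0 s, x + (s' : ℂ) * (σ : ℂ) ∈ enclosed T := by
    intro σ hσ
    obtain ⟨s, hs, hsT, hsΩ⟩ := exists_ray_hit h.isCompact_range hx (v := (σ : ℂ))
      (by rcases hσ with rfl | rfl <;> simp)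
    refine ⟨s, hs, hρA _ hsT ?_, hsΩ⟩
    have hσσ : σ * σ = 1 := by rcases hσ with rfl | rfl <;> norm_num
    have hs1 : s ≤ ρ / 3 + σ * (e.re - x.re) := by
      by_contra! hlt
      have hab : |σ * (e.re - x.re)| < κ := by
        rw [abs_mul, abs_sub_comm]
        rcases hσ with rfl | rfl <;> simpa using hxre
      obtain ⟨hab1, hab2⟩ := abs_lt.1 hab
      set s₀ := ρ / 3 + σ * (e.re - x.re) with hs₀
      have hw := hsΩ s₀ ⟨by linarith, hlt⟩
      set w := x + (s₀ : ℂ) * (σ : ℂ) with hwdef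
      have hwre : w.re - e.re = σ * (ρ / 3) := by
        simp [hwdef, hs₀]
        linear_combination (e.re - x.re) * hσσ
      have hwim : w.im = x.im := by simp [hwdef]
      obtain ⟨him1, him2⟩ := abs_lt.1 hxim
      have hnorm : ∀ y : ℂ, y.re = w.re → |y.im - e.im| < κ →
          |(y - e).re| = ρ / 3 ∧ ‖y - e‖ < ρ / 2 := fun y h1 h2 => by
        have h3 : |(y - e).re| = ρ / 3 := by
          rw [Complex.sub_re, h1, hwre, abs_mul, abs_of_pos (by linarith : 0 < ρ / 3)]
          rcases hσ with rfl | rfl <;> simp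
        have h4 := Complex.norm_le_abs_re_add_abs_im (y - e)
        rw [h3, Complex.sub_im] at h4
        exact ⟨h3, by linarith⟩
      have hpre : IsPreconnected ((fun r : ℝ => w + (r : ℂ) * Complex.I) '' uIcc 0 (e.im - x.im)) :=
        isPreconnected_uIcc.image _ (by fun_prop)
      have hyim : ∀ r ∈ uIcc 0 (e.im - x.im), |(x.im + r) - e.im| < κ ∧
          ε * x.im ≤ ε * (x.im + r) := fun r hr => by
        rw [abs_lt]
        rcases mem_uIcc.1 hr with hr | hr <;> rcases hε with rfl | rfl <;>
          refine ⟨⟨?_, ?_⟩, ?_⟩ <;> linarith [hr.1, hr.2]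
      have hdis : ¬ Disjoint ((fun r : ℝ => w + (r : ℂ) * Complex.I) '' uIcc 0 (e.im - x.im)) T := by
        intro hd
        have hsub := hpre.subset_enclosed hTc hd ⟨w, ⟨0, left_mem_uIcc, by simp⟩, hw⟩
        have hw' := hsub (mem_image_of_mem _ right_mem_uIcc)
        have hn := (hnorm (w + ((e.im - x.im : ℝ) : ℂ) * Complex.I) (by simp)
          (by simp [hwim, hκ])).2.trans (by linarith : ρ / 2 < ρ)
        have := hΩV _ hw' hn
        simp [hwim] at this
      obtain ⟨_, ⟨r, hr, rfl⟩, hyT⟩ := not_disjoint_iff.1 hdis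
      obtain ⟨h1, h2⟩ := hyim r hr
      have him : (w + (r : ℂ) * Complex.I).im = x.im + r := by simp [hwim]
      obtain ⟨h3, h4⟩ := hnorm (w + (r : ℂ) * Complex.I) (by simp) (by rwa [him])
      have h5 := hκN _ hyT h3 h4.le
      rw [him] at h5
      rcases hε with rfl | rfl <;> linarith
    have h4 := Complex.norm_le_abs_re_add_abs_im (x + (s : ℂ) * (σ : ℂ) - e)
    have h5 : (x + (s : ℂ) * (σ : ℂ) - e).re = x.re - e.re + σ * s := by simp; ring
    have h6 : (x + (s : ℂ) * (σ : ℂ) - e).im = x.im - e.im := by simp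
    have h7 : |x.re - e.re + σ * s| ≤ ρ / 2 := by
      obtain ⟨h8, h9⟩ := abs_lt.1 hxre
      rw [abs_le]
      rcases hσ with rfl | rfl <;> constructor <;> linarith
    rw [h5, h6] at h4
    linarith
  obtain ⟨s₁, hs₁, hb, hΩ₁⟩ := key 1 (Or.inl rfl)
  obtain ⟨s₂, hs₂, ha, hΩ₂⟩ := key (-1) (Or.inr rfl)
  have hx₁₂ : x ∈ segment ℝ (x + (s₁ : ℂ) * ((1 : ℝ) : ℂ)) (x + (s₂ : ℂ) * ((-1 : ℝ) : ℂ)) := by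
    refine ⟨s₂ / (s₁ + s₂), s₁ / (s₁ + s₂), by positivity, by positivity, by field_simp; ring, ?_⟩
    have : (s₁ + s₂ : ℂ) ≠ 0 := by exact_mod_cast (by positivity : s₁ + s₂ ≠ 0)
    simp only [Complex.real_smul]; push_cast; field_simp; ring
  refine hx.1 (hA _ hb _ ha ?_ hx₁₂)
  rintro y ⟨p, q, hp, hq, hpq, rfl⟩
  have hpq' : (p + q : ℂ) = 1 := by exact_mod_cast hpq
  have hy : p • (x + (s₁ : ℂ) * ((1 : ℝ) : ℂ)) + q • (x + (s₂ : ℂ) * ((-1 : ℝ) : ℂ)) =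
      x + ((p * s₁ - q * s₂ : ℝ) : ℂ) := by
    simp only [Complex.real_smul]; push_cast; linear_combination x * hpq'
  rw [hy]
  rcases le_total 0 (p * s₁ - q * s₂) with h0 | h0
  · rcases eq_or_lt_of_le (show p * s₁ - q * s₂ ≤ s₁ by nlinarith) with h1 | h1
    · right
      rw [h1]
      have := image_subset_range _ _ hb
      rwa [Complex.ofReal_one, mul_one] at this
    · left
      simpa using hΩ₁ _ ⟨h0, h1⟩
  · rcases eq_or_lt_of_le (show -(p * s₁ - q * s₂) ≤ s₂ by nlinarith) with h1 | h1
    · right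
      rw [← neg_neg (p * s₁ - q * s₂), h1]
      have := image_subset_range _ _ ha
      push_cast at this ⊢
      rwa [mul_neg_one] at this
    · left
      have := hΩ₂ _ ⟨by linarith, h1⟩
      push_cast at this ⊢
      simpa [sub_eq_add_neg, add_comm] using this

end IsLoop

/-- No segment between two points of `A` runs through the region enclosed by `T`. -/
def IsChordless (T A : Set ℂ) : Prop :=
  ∀ a ∈ A, ∀ b ∈ A, segment ℝ a b ⊆ enclosed T ∪ T → segment ℝ a b ⊆ T

/-- `e` is a strict local maximum (`ε = 1`) or minimum (`ε = -1`) of the height on `T`. -/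
def IsStrictExtremum (T : Set ℂ) (e : ℂ) : Prop :=
  ∃ ε : ℝ, (ε = 1 ∨ ε = -1) ∧ ∃ δ > 0, ∀ y ∈ T, ‖y - e‖ < δ → y ≠ e → ε * y.im < ε * e.im

theorem exists_chord {T : Set ℂ} (hT : IsCompact T) {e : ℂ} {σ ρ : ℝ} (hσ : σ = 1 ∨ σ = -1)
    (hρ : 0 < ρ) (h : ∀ s : ℝ, 0 < s → s < ρ → e + (s : ℂ) * (σ : ℂ) ∈ enclosed T) :
    ∃ R : ℝ, 0 < R ∧ e + (R : ℂ) * (σ : ℂ) ∈ T ∧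
      ∀ s : ℝ, 0 < s → s < R → e + (s : ℂ) * (σ : ℂ) ∈ enclosed T := by
  obtain ⟨t, ht, htT, hts⟩ := exists_ray_hit hT (h (ρ / 2) (by linarith) (by linarith))
    (v := (σ : ℂ)) (by rcases hσ with rfl | rfl <;> simp)
  refine ⟨ρ / 2 + t, by linarith, ?_, fun s hs0 hs => ?_⟩
  · convert htT using 1
    push_cast; ring
  · rcases lt_or_ge s (ρ / 2) with h1 | h1
    · exact h s hs0 (by linarith)
    · convert hts (s - ρ / 2) ⟨by linarith, by linarith⟩ using 1
      push_cast; ring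

namespace IsLoop

variable {Ψ : ℝ → ℂ}

theorem exists_chords (h : IsLoop Ψ) (hne : (enclosed (range Ψ)).Nonempty) {α₀ α₁ m t : ℝ}
    (ht : t ∈ Ioo α₀ α₁) (hα : α₁ < α₀ + 2 * Real.pi)
    (hA : IsChordless (range Ψ) (Ψ '' Icc α₀ α₁)) (hC : IsChordless (range Ψ) (Ψ '' Icc α₁ m))
    (hB : IsChordless (range Ψ) (Ψ '' Icc m (α₀ + 2 * Real.pi)))
    (he : IsStrictExtremum (range Ψ) (Ψ t)) :
    ∃ ξ ∈ Ioo α₁ m, ∃ υ ∈ Ioo m (α₀ + 2 * Real.pi),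
      (Ψ ξ).im = (Ψ t).im ∧ (Ψ υ).im = (Ψ t).im ∧
      openSegment ℝ (Ψ t) (Ψ ξ) ⊆ enclosed (range Ψ) ∧
      openSegment ℝ (Ψ t) (Ψ υ) ⊆ enclosed (range Ψ) := by
  obtain ⟨ε, hε, δ, hδ, hext⟩ := he
  obtain ⟨ρ, hρ, hnear⟩ := h.enclosed_near_extremum hne ht hα hA hε hδ hext
  set T := range Ψ with hT
  set e := Ψ t with hedef
  have heT : e ∈ T := mem_range_self t
  have heA : e ∈ Ψ '' Icc α₀ α₁ := ⟨t, Ioo_subset_Icc_self ht, rfl⟩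
  have key : ∀ σ : ℝ, σ = 1 ∨ σ = -1 → ∃ R : ℝ, 0 < R ∧ e + (R : ℂ) * (σ : ℂ) ∈ T ∧
      ∀ s : ℝ, 0 < s → s < R → e + (s : ℂ) * (σ : ℂ) ∈ enclosed T := fun σ hσ => by
    refine exists_chord h.isCompact_range hσ hρ fun s hs0 hs => hnear _ ?_ ?_ ?_
    · rw [add_sub_cancel_left, norm_mul, Complex.norm_real, Complex.norm_real, Real.norm_eq_abs,
        Real.norm_eq_abs, abs_of_pos hs0]
      rcases hσ with rfl | rfl <;> simpa using hs
    · simp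
    · rcases hσ with rfl | rfl <;> simp [hs0.ne']
  have hopen : ∀ (R σ : ℝ), (∀ s : ℝ, 0 < s → s < R → e + (s : ℂ) * (σ : ℂ) ∈ enclosed T) →
      0 < R → openSegment ℝ e (e + (R : ℂ) * (σ : ℂ)) ⊆ enclosed T := by
    rintro R σ hs hR _ ⟨p, q, hp, hq, hpq, rfl⟩
    have hpq' : (p + q : ℂ) = 1 := by exact_mod_cast hpq
    convert hs (q * R) (by positivity) (by nlinarith) using 1
    simp only [Complex.real_smul]; push_cast; linear_combination e * hpq'
  obtain ⟨R₁, hR₁, hT₁, hs₁⟩ := key 1 (Or.inl rfl)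
  obtain ⟨R₂, hR₂, hT₂, hs₂⟩ := key (-1) (Or.inr rfl)
  have ho₁ := hopen _ _ hs₁ hR₁
  have ho₂ := hopen _ _ hs₂ hR₂
  have hi₁ : (e + (R₁ : ℂ) * ((1 : ℝ) : ℂ)).im = e.im := by simp
  have hi₂ : (e + (R₂ : ℂ) * ((-1 : ℝ) : ℂ)).im = e.im := by simp
  have hbetw : ∀ y ∈ segment ℝ (e + (R₁ : ℂ) * ((1 : ℝ) : ℂ)) (e + (R₂ : ℂ) * ((-1 : ℝ) : ℂ)),
      y ∈ enclosed T ∪ T := by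
    rintro y ⟨p, q, hp, hq, hpq, rfl⟩
    have hpq' : (p + q : ℂ) = 1 := by exact_mod_cast hpq
    have hy : p • (e + (R₁ : ℂ) * ((1 : ℝ) : ℂ)) + q • (e + (R₂ : ℂ) * ((-1 : ℝ) : ℂ)) =
        e + ((p * R₁ - q * R₂ : ℝ) : ℂ) := by
      simp only [Complex.real_smul]; push_cast; linear_combination e * hpq'
    rw [hy]
    rcases lt_trichotomy 0 (p * R₁ - q * R₂) with h0 | h0 | h0
    · rcases eq_or_lt_of_le (show p * R₁ - q * R₂ ≤ R₁ by nlinarith) with h1 | h1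
      · right
        rw [h1]
        rwa [Complex.ofReal_one, mul_one] at hT₁
      · left
        simpa using hs₁ _ h0 h1
    · right
      rw [← h0]
      simpa using heT
    · rcases eq_or_lt_of_le (show -(p * R₁ - q * R₂) ≤ R₂ by nlinarith) with h1 | h1
      · right
        rw [← neg_neg (p * R₁ - q * R₂), h1]
        push_cast at hT₂ ⊢
        rwa [mul_neg_one] at hT₂
      · left
        have := hs₂ _ (by linarith) h1
        push_cast at this ⊢
        simpa [sub_eq_add_neg, add_comm] using this
  have he₁₂ : ∀ z ∈ enclosed T, z ∈ segment ℝ (e + (R₁ : ℂ) * ((1 : ℝ) : ℂ))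
      (e + (R₂ : ℂ) * ((-1 : ℝ) : ℂ)) → ¬ segment ℝ (e + (R₁ : ℂ) * ((1 : ℝ) : ℂ))
      (e + (R₂ : ℂ) * ((-1 : ℝ) : ℂ)) ⊆ T := fun z hz hzs hsub => hz.1 (hsub hzs)
  obtain ⟨z, hz, hzs⟩ : ∃ z ∈ enclosed T, z ∈ segment ℝ (e + (R₁ : ℂ) * ((1 : ℝ) : ℂ))
      (e + (R₂ : ℂ) * ((-1 : ℝ) : ℂ)) := by
    have hR : (R₁ + R₂ : ℂ) ≠ 0 := by exact_mod_cast (by positivity : R₁ + R₂ ≠ 0)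
    refine ⟨_, hs₁ (R₁ / 2) (by linarith) (by linarith), (R₁ / 2 + R₂) / (R₁ + R₂),
      (R₁ / 2) / (R₁ + R₂), by positivity, by positivity, by field_simp; ring, ?_⟩
    simp only [Complex.real_smul]; push_cast; field_simp; ring
  have hnot₁₂ := he₁₂ z hz hzs
  have hnotA : ∀ w, openSegment ℝ e w ⊆ enclosed T → w ∈ T → w ≠ e → w ∉ Ψ '' Icc α₀ α₁ := by
    intro w hw hwT hwe hwA
    have hsub := hA e heA w hwA (by
      rw [segment_eq_insert_openSegment]
      rintro y ((rfl | rfl) | hy)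
      · exact Or.inr heT
      · exact Or.inr hwT
      · exact Or.inl (hw hy))
    obtain ⟨y, hy⟩ : (openSegment ℝ e w).Nonempty := ⟨_, midpoint_mem_openSegment e w⟩
    exact (hw hy).1 (hsub (openSegment_subset_segment ℝ _ _ hy))
  have hpar : ∀ w ∈ T, w ∉ Ψ '' Icc α₀ α₁ → ∃ ξ ∈ Ioo α₁ (α₀ + 2 * Real.pi), Ψ ξ = w := by
    rintro w hw hwA
    rw [hT, ← h.union_arcs (ht.1.trans ht.2).le hα.le] at hw
    obtain ⟨ξ, hξ, rfl⟩ := hw.resolve_left hwA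
    refine ⟨ξ, ⟨lt_of_le_of_ne hξ.1 ?_, lt_of_le_of_ne hξ.2 ?_⟩, rfl⟩
    · rintro rfl
      exact hwA ⟨α₁, ⟨(ht.1.trans ht.2).le, le_rfl⟩, rfl⟩
    · rintro rfl
      exact hwA ⟨α₀, ⟨le_rfl, (ht.1.trans ht.2).le⟩, (h.periodic α₀).symm⟩
  obtain ⟨ξ₁, hξ₁, hξ₁e⟩ := hpar _ hT₁ (hnotA _ ho₁ hT₁ (by simp [hR₁.ne']))
  obtain ⟨ξ₂, hξ₂, hξ₂e⟩ := hpar _ hT₂ (hnotA _ ho₂ hT₂ (by simp [hR₂.ne']))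
  rw [← hξ₁e, ← hξ₂e] at hbetw hnot₁₂
  rw [← hξ₁e] at ho₁ hi₁
  rw [← hξ₂e] at ho₂ hi₂
  have hnotC : ¬ (ξ₁ ≤ m ∧ ξ₂ ≤ m) := fun hh => hnot₁₂
    (hC _ ⟨ξ₁, ⟨hξ₁.1.le, hh.1⟩, rfl⟩ _ ⟨ξ₂, ⟨hξ₂.1.le, hh.2⟩, rfl⟩ hbetw)
  have hnotB : ¬ (m ≤ ξ₁ ∧ m ≤ ξ₂) := fun hh => hnot₁₂
    (hB _ ⟨ξ₁, ⟨hh.1, hξ₁.2.le⟩, rfl⟩ _ ⟨ξ₂, ⟨hh.2, hξ₂.2.le⟩, rfl⟩ hbetw)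
  rcases lt_trichotomy ξ₁ m with h1 | h1 | h1
  · have h2 : m < ξ₂ := not_le.1 fun hh => hnotC ⟨h1.le, hh⟩
    exact ⟨ξ₁, ⟨hξ₁.1, h1⟩, ξ₂, ⟨h2, hξ₂.2⟩, hi₁, hi₂, ho₁, ho₂⟩
  · rcases le_total ξ₂ m with h2 | h2
    · exact absurd ⟨h1.le, h2⟩ hnotC
    · exact absurd ⟨h1.ge, h2⟩ hnotB
  · have h2 : ξ₂ < m := not_le.1 fun hh => hnotB ⟨h1.le, hh⟩
    exact ⟨ξ₂, ⟨hξ₂.1, h2⟩, ξ₁, ⟨h1, hξ₁.2⟩, hi₂, hi₁, ho₂, ho₁⟩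

end IsLoop

theorem eq_of_mem_Ioo_of_notMem_Ioo {p q p' q' w : ℝ} (hw : w ∈ Ioo (min p q) (max p q))
    (hw' : w ∈ Ioo (min p' q') (max p' q')) (hp : p ∉ Ioo (min p' q') (max p' q'))
    (hq : q ∉ Ioo (min p' q') (max p' q')) (hp' : p' ∉ Ioo (min p q) (max p q))
    (hq' : q' ∉ Ioo (min p q) (max p q)) : p' = p ∨ p' = q := by
  simp only [mem_Ioo, not_and, min_lt_iff, lt_max_iff] at *
  grind

namespace IsLoop

variable {Ψ : ℝ → ℂ}

theorem not_two_strict_extrema (h : IsLoop Ψ) (hne : (enclosed (range Ψ)).Nonempty)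
    {α₀ α₁ m t₁ t₂ : ℝ} (ht₁ : t₁ ∈ Ioo α₀ α₁) (ht₂ : t₂ ∈ Ioo α₀ α₁) (ht : t₁ < t₂)
    (hα : α₁ < α₀ + 2 * Real.pi)
    (hA : IsChordless (range Ψ) (Ψ '' Icc α₀ α₁)) (hC : IsChordless (range Ψ) (Ψ '' Icc α₁ m))
    (hB : IsChordless (range Ψ) (Ψ '' Icc m (α₀ + 2 * Real.pi)))
    (he₁ : IsStrictExtremum (range Ψ) (Ψ t₁)) (he₂ : IsStrictExtremum (range Ψ) (Ψ t₂)) :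
    False := by
  obtain ⟨ξ, hξ, -, -, hi₁, -, ho₁, -⟩ := h.exists_chords hne ht₁ hα hA hC hB he₁
  obtain ⟨-, -, υ, hυ, -, hi₂, -, ho₂⟩ := h.exists_chords hne ht₂ hα hA hC hB he₂
  have inj : ∀ x y, x < y → y < x + 2 * Real.pi → Ψ x ≠ Ψ y := fun x y h1 h2 h3 => by
    have := h.eq_of_abs_sub_lt h3 (by rw [abs_lt]; constructor <;> linarith)
    linarith
  have hξυ : ξ < υ := hξ.2.trans hυ.1
  have hξ' : ξ < α₀ + 2 * Real.pi := hξυ.trans hυ.2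
  have hυ' : α₁ < υ := hξ.1.trans hξυ
  have n₁₂ := inj t₁ t₂ ht (by linarith [ht₁.1, ht₂.2])
  have n₁ξ := inj t₁ ξ (by linarith [ht₁.2, hξ.1]) (by linarith [ht₁.1])
  have n₂ξ := inj t₂ ξ (by linarith [ht₂.2, hξ.1]) (by linarith [ht₂.1])
  have n₂υ := inj t₂ υ (by linarith [ht₂.2]) (by linarith [hυ.2, ht₂.1])
  refine h.not_linked ht (by linarith [ht₂.2, hξ.1] : t₂ < ξ) hξυ
    (by linarith [hυ.2, ht₁.1]) ho₁ (S := openSegment ℝ (Ψ t₂) (Ψ υ))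
    (convex_openSegment _ _).isPreconnected ho₂ ?_ ?_ ?_
  · refine disjoint_left.2 fun w hw hw' => ?_
    have hwT := (ho₂ hw).1
    have hw₁ : w ∈ openSegment ℝ (Ψ t₁) (Ψ ξ) := by
      rw [segment_eq_insert_openSegment] at hw'
      rcases hw' with (rfl | rfl) | hw'
      · exact absurd (mem_range_self _) hwT
      · exact absurd (mem_range_self _) hwT
      · exact hw'
    have iff₁ := fun w => Complex.mem_openSegment_iff_of_im_eq (w := w) hi₁.symm n₁ξ
    have iff₂ := fun w => Complex.mem_openSegment_iff_of_im_eq (w := w) hi₂.symm n₂υ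
    obtain ⟨him, hre⟩ := (iff₂ w).1 hw
    obtain ⟨him₁, hre₁⟩ := (iff₁ w).1 hw₁
    have not₁ : ∀ x, (Ψ x).im = w.im →
        (Ψ x).re ∉ Ioo (min (Ψ t₁).re (Ψ ξ).re) (max (Ψ t₁).re (Ψ ξ).re) := fun x hx hx' =>
      (ho₁ ((iff₁ _).2 ⟨hx.trans him₁, hx'⟩)).1 (mem_range_self x)
    have not₂ : ∀ x, (Ψ x).im = w.im →
        (Ψ x).re ∉ Ioo (min (Ψ t₂).re (Ψ υ).re) (max (Ψ t₂).re (Ψ υ).re) := fun x hx hx' =>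
      (ho₂ ((iff₂ _).2 ⟨hx.trans him, hx'⟩)).1 (mem_range_self x)
    rcases eq_of_mem_Ioo_of_notMem_Ioo hre₁ hre (not₂ _ him₁.symm) (not₂ _ (hi₁.trans him₁.symm))
      (not₁ _ him.symm) (not₁ _ (hi₂.trans him.symm)) with heq | heq
    · exact n₁₂ (Complex.ext heq.symm (him₁.symm.trans him))
    · exact n₂ξ (Complex.ext heq (him.symm.trans (him₁.trans hi₁.symm)))
  · rw [closure_openSegment]; exact left_mem_segment ℝ _ _
  · rw [closure_openSegment]; exact right_mem_segment ℝ _ _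

end IsLoop

/-- `f` has a strict local maximum or minimum at `e`. -/
def IsStrictLocalExtr (f : ℝ → ℝ) (e : ℝ) : Prop :=
  ∃ ε : ℝ, (ε = 1 ∨ ε = -1) ∧ ∃ η > 0, ∀ s, |s - e| < η → s ≠ e → ε * f s < ε * f e

theorem countable_setOf_two_maximizers {x y : ℝ → ℝ} {I : Set ℝ}
    (hinj : ∀ s ∈ I, ∀ t ∈ I, x s = x t → y s = y t → s = t) :
    {θ : ℝ | ∃ s ∈ I, ∃ t ∈ I, s ≠ t ∧ IsMaxOn (fun r => y r + θ * x r) I s ∧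
      IsMaxOn (fun r => y r + θ * x r) I t}.Countable := by
  set Θ := {θ : ℝ | ∃ s ∈ I, ∃ t ∈ I, s ≠ t ∧ IsMaxOn (fun r => y r + θ * x r) I s ∧
    IsMaxOn (fun r => y r + θ * x r) I t} with hΘ
  have hmono : ∀ θ θ' s s', θ < θ' → s ∈ I → s' ∈ I → IsMaxOn (fun r => y r + θ * x r) I s →
      IsMaxOn (fun r => y r + θ' * x r) I s' → x s ≤ x s' := by
    intro θ θ' s s' hlt hs hs' h h'
    have h1 : y s' + θ * x s' ≤ y s + θ * x s := h hs'
    have h2 : y s + θ' * x s ≤ y s' + θ' * x s' := h' hs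
    nlinarith
  have hex : ∀ θ : ℝ, ∃ s t : ℝ, θ ∈ Θ → s ∈ I ∧ t ∈ I ∧ x s < x t ∧
      IsMaxOn (fun r => y r + θ * x r) I s ∧ IsMaxOn (fun r => y r + θ * x r) I t := by
    intro θ
    by_cases hθ : θ ∈ Θ
    · obtain ⟨s, hs, t, ht, hst, h1, h2⟩ := hθ
      have h3 : y s + θ * x s ≤ y t + θ * x t := h2 hs
      have h4 : y t + θ * x t ≤ y s + θ * x s := h1 ht
      rcases lt_trichotomy (x s) (x t) with h | h | h
      · exact ⟨s, t, fun _ => ⟨hs, ht, h, h1, h2⟩⟩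
      · rw [h] at h3 h4
        exact absurd (hinj s hs t ht h (by linarith)) hst
      · exact ⟨t, s, fun _ => ⟨ht, hs, h, h2, h1⟩⟩
    · exact ⟨0, 0, fun h => absurd h hθ⟩
  choose s t hst using hex
  have hdisj : ∀ θ ∈ Θ, ∀ θ' ∈ Θ, θ < θ' →
      Disjoint (Ioo (x (s θ)) (x (t θ))) (Ioo (x (s θ')) (x (t θ'))) := by
    intro θ hθ θ' hθ' hlt
    obtain ⟨-, h1, -, -, h2⟩ := hst θ hθ
    obtain ⟨h3, -, -, h4, -⟩ := hst θ' hθ'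
    have := hmono _ _ _ _ hlt h1 h3 h2 h4
    exact disjoint_left.2 fun w hw hw' => by linarith [hw.2, hw'.1]
  refine PairwiseDisjoint.countable_of_isOpen (s := fun θ => Ioo (x (s θ)) (x (t θ)))
    (fun θ hθ θ' hθ' hne => ?_) (fun θ _ => isOpen_Ioo) (fun θ hθ => nonempty_Ioo.2 (hst θ hθ).2.2.1)
  rcases lt_or_gt_of_ne hne with h | h
  · exact hdisj θ hθ θ' hθ' h
  · exact (hdisj θ' hθ' θ hθ h).symm

theorem exists_strict_max {x y : ℝ → ℝ} {a b θ : ℝ} (hab : a ≤ b) (hx : Continuous x)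
    (hy : Continuous y)
    (hθ : θ ∉ {θ : ℝ | ∃ s ∈ Icc a b, ∃ t ∈ Icc a b, s ≠ t ∧
      IsMaxOn (fun r => y r + θ * x r) (Icc a b) s ∧
      IsMaxOn (fun r => y r + θ * x r) (Icc a b) t}) :
    ∃ e ∈ Icc a b, ∀ s ∈ Icc a b, s ≠ e → y s + θ * x s < y e + θ * x e := by
  obtain ⟨e, he, hmax⟩ := (isCompact_Icc (a := a) (b := b)).exists_isMaxOn ⟨a, le_rfl, hab⟩
    (f := fun r => y r + θ * x r) (by fun_prop)
  refine ⟨e, he, fun s hs hse => lt_of_le_of_ne (hmax hs) fun heq => hθ ?_⟩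
  refine ⟨s, hs, e, he, hse, fun r hr => ?_, hmax⟩
  have : y r + θ * x r ≤ y e + θ * x e := hmax hr
  simp only [mem_ofPred_eq]
  linarith

theorem exists_two_extrema_of_pos {x y : ℝ → ℝ} {s₁ s₂ s₃ s : ℝ} (hx : Continuous x)
    (hy : Continuous y) (hinj : ∀ s ∈ Icc s₁ s₃, ∀ t ∈ Icc s₁ s₃, x s = x t → y s = y t → s = t)
    (h₂₃ : s₂ < s₃) (hy₁ : y s₁ = 0) (hy₂ : y s₂ = 0) (hy₃ : y s₃ = 0)
    (hs : s ∈ Ioo s₁ s₂) (hys : 0 < y s) (hx₂₃ : x s₂ < x s₃) :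
    ∃ θ : ℝ, ∃ e₁ ∈ Ioo s₁ s₃, ∃ e₂ ∈ Ioo s₁ s₃, e₁ ≠ e₂ ∧
      IsStrictLocalExtr (fun r => y r + θ * x r) e₁ ∧
      IsStrictLocalExtr (fun r => y r + θ * x r) e₂ := by
  obtain ⟨M, hM⟩ := (isCompact_Icc (a := s₁) (b := s₃)).exists_bound_of_continuousOn hx.continuousOn
  simp only [Real.norm_eq_abs] at hM
  have m₁ : s₁ ∈ Icc s₁ s₃ := ⟨le_rfl, by linarith [hs.1, hs.2]⟩
  have m₂ : s₂ ∈ Icc s₁ s₃ := ⟨by linarith [hs.1, hs.2], h₂₃.le⟩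
  have ms : s ∈ Icc s₁ s₃ := ⟨hs.1.le, by linarith [hs.2]⟩
  have hM0 : 0 ≤ M := (abs_nonneg _).trans (hM _ m₁)
  have hc₁ := countable_setOf_two_maximizers (x := x) (y := y) (I := Icc s₁ s₂)
    fun a ha b hb => hinj a ⟨ha.1, by linarith [ha.2]⟩ b ⟨hb.1, by linarith [hb.2]⟩
  have hc₂ := countable_setOf_two_maximizers (x := fun r => -x r) (y := fun r => -y r)
    (I := Icc s s₃) fun a ha b hb h1 h2 => hinj a ⟨by linarith [ha.1, hs.1], ha.2⟩ b
      ⟨by linarith [hb.1, hs.1], hb.2⟩ (neg_injective h1) (neg_injective h2)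
  obtain ⟨θ, hθ, hθn⟩ : (Ioo 0 (y s / (2 * M + 1)) \ (_ ∪ _)).Nonempty :=
    sdiff_nonempty.2 fun hsub => Cardinal.not_countable_real (by
      have := (Cardinal.mk_Ioo_real (show 0 < y s / (2 * M + 1) by positivity))
      have h2 := (hc₁.union hc₂).mono hsub
      rw [← Cardinal.le_aleph0_iff_set_countable, this] at h2
      exact absurd h2 (not_le.2 Cardinal.aleph0_lt_continuum))
  rw [mem_union, not_or] at hθn
  have hθM : θ * (2 * M + 1) < y s := (lt_div_iff₀ (by positivity)).1 hθ.2
  have hb : ∀ r ∈ Icc s₁ s₃, |θ * x r| ≤ θ * M := fun r hr => by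
    rw [abs_mul, abs_of_pos hθ.1]
    exact mul_le_mul_of_nonneg_left (hM r hr) hθ.1.le
  obtain ⟨l₁, u₁⟩ := abs_le.1 (hb _ m₁)
  obtain ⟨l₂, u₂⟩ := abs_le.1 (hb _ m₂)
  obtain ⟨l, u⟩ := abs_le.1 (hb _ ms)
  have hθ0 := hθ.1
  obtain ⟨e₁, he₁, hmax⟩ := exists_strict_max (by linarith [hs.1, hs.2]) hx hy hθn.1
  obtain ⟨e₂, he₂, hmin⟩ := exists_strict_max (by linarith [hs.2]) hx.neg hy.neg hθn.2
  have hmin' : ∀ r ∈ Icc s s₃, r ≠ e₂ → y e₂ + θ * x e₂ < y r + θ * x r := fun r hr hne => by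
    have : -y r + θ * -x r < -y e₂ + θ * -x e₂ := hmin r hr hne
    linarith
  have hI₁ : e₁ ∈ Ioo s₁ s₂ := by
    have hle : y s + θ * x s ≤ y e₁ + θ * x e₁ := by
      rcases eq_or_ne s e₁ with rfl | hne
      · exact le_rfl
      · exact (hmax s ⟨hs.1.le, hs.2.le⟩ hne).le
    refine ⟨lt_of_le_of_ne he₁.1 ?_, lt_of_le_of_ne he₁.2 ?_⟩ <;> rintro rfl <;> nlinarith
  have hI₂ : e₂ ∈ Ioo s s₃ := by
    have hle : y e₂ + θ * x e₂ ≤ y s₂ + θ * x s₂ := by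
      rcases eq_or_ne s₂ e₂ with rfl | hne
      · exact le_rfl
      · exact (hmin' s₂ ⟨hs.2.le, h₂₃.le⟩ hne).le
    refine ⟨lt_of_le_of_ne he₂.1 ?_, lt_of_le_of_ne he₂.2 ?_⟩ <;> rintro rfl <;> nlinarith
  refine ⟨θ, e₁, ⟨hI₁.1, hI₁.2.trans h₂₃⟩, e₂, ⟨hs.1.trans hI₂.1, hI₂.2⟩, ?_,
    ⟨1, Or.inl rfl, min (e₁ - s₁) (s₂ - e₁), lt_min (by linarith [hI₁.1]) (by linarith [hI₁.2]),
      fun r hr hne => ?_⟩,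
    ⟨-1, Or.inr rfl, min (e₂ - s) (s₃ - e₂), lt_min (by linarith [hI₂.1]) (by linarith [hI₂.2]),
      fun r hr hne => ?_⟩⟩
  · rintro rfl
    obtain ⟨r, hr1, hr2⟩ := exists_between hI₁.2
    have h1 := hmax r ⟨by linarith [hI₁.1], hr2.le⟩ hr1.ne'
    have h2 := hmin' r ⟨by linarith [hI₂.1], by linarith⟩ hr1.ne'
    linarith
  · rw [lt_min_iff, abs_lt, abs_lt] at hr
    have := hmax r ⟨by linarith [hr.1.1], by linarith [hr.2.2]⟩ hne
    linarith
  · rw [lt_min_iff, abs_lt, abs_lt] at hr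
    have := hmin' r ⟨by linarith [hr.1.1], by linarith [hr.2.2]⟩ hne
    linarith

theorem IsStrictLocalExtr.neg {f : ℝ → ℝ} {e : ℝ} (h : IsStrictLocalExtr f e) :
    IsStrictLocalExtr (fun r => -f r) e := by
  obtain ⟨ε, hε, η, hη, h⟩ := h
  refine ⟨-ε, ?_, η, hη, fun s hs hne => ?_⟩
  · rcases hε with rfl | rfl <;> simp
  · have := h s hs hne
    linarith

theorem IsStrictLocalExtr.comp_neg {f : ℝ → ℝ} {e : ℝ}
    (h : IsStrictLocalExtr (fun r => f (-r)) e) : IsStrictLocalExtr f (-e) := by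
  obtain ⟨ε, hε, η, hη, h⟩ := h
  refine ⟨ε, hε, η, hη, fun s hs hne => ?_⟩
  have := h (-s) (by rw [← abs_neg]; convert hs using 2; ring) (fun h' => hne (by linarith))
  simpa using this

theorem exists_two_extrema_of_mem_left {x y : ℝ → ℝ} {s₁ s₂ s₃ s : ℝ} (hx : Continuous x)
    (hy : Continuous y) (hinj : ∀ s ∈ Icc s₁ s₃, ∀ t ∈ Icc s₁ s₃, x s = x t → y s = y t → s = t)
    (h₂₃ : s₂ < s₃) (hy₁ : y s₁ = 0) (hy₂ : y s₂ = 0) (hy₃ : y s₃ = 0)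
    (hs : s ∈ Ioo s₁ s₂) (hys : y s ≠ 0) :
    ∃ θ : ℝ, ∃ e₁ ∈ Ioo s₁ s₃, ∃ e₂ ∈ Ioo s₁ s₃, e₁ ≠ e₂ ∧
      IsStrictLocalExtr (fun r => y r + θ * x r) e₁ ∧
      IsStrictLocalExtr (fun r => y r + θ * x r) e₂ := by
  wlog hpos : 0 < y s generalizing y
  · obtain ⟨θ, e₁, he₁, e₂, he₂, hne, h₁, h₂⟩ := this hy.neg
      (fun a ha b hb h1 h2 => hinj a ha b hb h1 (neg_injective h2)) (by simp [hy₁]) (by simp [hy₂])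
      (by simp [hy₃]) (by simpa using hys)
      (by simpa using lt_of_le_of_ne (not_lt.1 hpos) hys)
    refine ⟨-θ, e₁, he₁, e₂, he₂, hne, ?_, ?_⟩
    · convert h₁.neg using 2
      simp; ring
    · convert h₂.neg using 2
      simp; ring
  wlog hlt : x s₂ < x s₃ generalizing x
  · have hne₂₃ : x s₂ ≠ x s₃ := fun h => h₂₃.ne (hinj _ ⟨by linarith [hs.1, hs.2], h₂₃.le⟩ _
      ⟨by linarith [hs.1, hs.2], le_rfl⟩ h (hy₂.trans hy₃.symm))
    obtain ⟨θ, e₁, he₁, e₂, he₂, hne, h₁, h₂⟩ := this hx.neg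
      (fun a ha b hb h1 h2 => hinj a ha b hb (neg_injective h1) h2)
      (by simpa using lt_of_le_of_ne (not_lt.1 hlt) hne₂₃.symm)
    refine ⟨-θ, e₁, he₁, e₂, he₂, hne, ?_, ?_⟩
    · convert h₁ using 2
      simp
    · convert h₂ using 2
      simp
  exact exists_two_extrema_of_pos hx hy hinj h₂₃ hy₁ hy₂ hy₃ hs hpos hlt

/-- A plane arc through three points of a line, but not contained in it, has two interior strict
height extrema with respect to some direction. -/
theorem exists_two_extrema {x y : ℝ → ℝ} {s₁ s₂ s₃ s : ℝ} (hx : Continuous x)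
    (hy : Continuous y) (hinj : ∀ s ∈ Icc s₁ s₃, ∀ t ∈ Icc s₁ s₃, x s = x t → y s = y t → s = t)
    (h₁₂ : s₁ < s₂) (h₂₃ : s₂ < s₃) (hy₁ : y s₁ = 0) (hy₂ : y s₂ = 0) (hy₃ : y s₃ = 0)
    (hs : s ∈ Icc s₁ s₃) (hys : y s ≠ 0) :
    ∃ θ : ℝ, ∃ e₁ ∈ Ioo s₁ s₃, ∃ e₂ ∈ Ioo s₁ s₃, e₁ ≠ e₂ ∧
      IsStrictLocalExtr (fun r => y r + θ * x r) e₁ ∧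
      IsStrictLocalExtr (fun r => y r + θ * x r) e₂ := by
  have n₁ : s ≠ s₁ := by rintro rfl; exact hys hy₁
  have n₂ : s ≠ s₂ := by rintro rfl; exact hys hy₂
  have n₃ : s ≠ s₃ := by rintro rfl; exact hys hy₃
  rcases lt_or_gt_of_ne n₂ with h | h
  · exact exists_two_extrema_of_mem_left hx hy hinj h₂₃ hy₁ hy₂ hy₃
      ⟨lt_of_le_of_ne hs.1 n₁.symm, h⟩ hys
  · obtain ⟨θ, e₁, he₁, e₂, he₂, hne, h₁, h₂⟩ := exists_two_extrema_of_mem_left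
      (x := fun r => x (-r)) (y := fun r => y (-r)) (s₁ := -s₃) (s₂ := -s₂) (s₃ := -s₁) (s := -s)
      (hx.comp continuous_neg) (hy.comp continuous_neg) (fun a ha b hb h1 h2 => by
        have := hinj (-a) ⟨by linarith [ha.2], by linarith [ha.1]⟩ (-b)
          ⟨by linarith [hb.2], by linarith [hb.1]⟩ h1 h2
        linarith)
      (by linarith) (by simpa using hy₃) (by simpa using hy₂) (by simpa using hy₁)
      ⟨by linarith [lt_of_le_of_ne hs.2 n₃], by linarith⟩ (by simpa using hys)
    exact ⟨θ, -e₁, ⟨by linarith [he₁.2], by linarith [he₁.1]⟩, -e₂,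
      ⟨by linarith [he₂.2], by linarith [he₂.1]⟩, fun h' => hne (by linarith),
      IsStrictLocalExtr.comp_neg (f := fun r => y r + θ * x r) h₁,
      IsStrictLocalExtr.comp_neg (f := fun r => y r + θ * x r) h₂⟩

namespace IsLoop

theorem isStrictExtremum {Ψ : ℝ → ℂ} (h : IsLoop Ψ) {e : ℝ}
    (he : IsStrictLocalExtr (fun s => (Ψ s).im) e) : IsStrictExtremum (range Ψ) (Ψ e) := by
  obtain ⟨ε, hε, η, hη, hlt⟩ := he
  obtain ⟨κ, hκ, hκ'⟩ := exists_between (lt_min hη Real.pi_pos)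
  obtain ⟨hκη, hκπ⟩ := lt_min_iff.1 hκ'
  set K := Ψ '' Icc (e + κ) (e + 2 * Real.pi - κ)
  have hK : IsClosed K := (isCompact_Icc.image h.continuous).isClosed
  have heK : Ψ e ∈ Kᶜ := by
    rintro ⟨s, hs, hse⟩
    have := h.eq_of_abs_sub_lt hse (by rw [abs_lt]; constructor <;> linarith [hs.1, hs.2])
    linarith [hs.1]
  obtain ⟨δ, hδ, hball⟩ := Metric.isOpen_iff.1 hK.isOpen_compl _ heK
  refine ⟨ε, hε, δ, hδ, ?_⟩
  rintro _ ⟨s', rfl⟩ hd hne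
  obtain ⟨s, hs, hs'⟩ := h.exists_mem_Ico (e - κ) s'
  rw [← hs'] at hd hne ⊢
  have hse : s < e + κ := not_le.1 fun hle =>
    hball (mem_ball_iff_norm.2 hd) ⟨s, ⟨hle, by linarith [hs.2]⟩, rfl⟩
  exact hlt s (by rw [abs_lt]; constructor <;> linarith [hs.1]) fun h => hne (by rw [h])

end IsLoop

/-- The shear `(x, y) ↦ (x, y + θ x)` of the complex plane. -/
noncomputable def Complex.shear (θ : ℝ) : ℂ ≃L[ℝ] ℂ :=
  LinearEquiv.toContinuousLinearEquiv
    { toFun := fun w => ⟨w.re, w.im + θ * w.re⟩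
      invFun := fun w => ⟨w.re, w.im - θ * w.re⟩
      map_add' := fun v w => by
        apply Complex.ext <;> simp
        ring
      map_smul' := fun r w => by
        apply Complex.ext <;> simp
        ring
      left_inv := fun w => by simp
      right_inv := fun w => by simp }

theorem Complex.im_shear (θ : ℝ) (w : ℂ) : (Complex.shear θ w).im = w.im + θ * w.re := rfl

theorem isChordless_image {V : Type*} [NormedAddCommGroup V] [NormedSpace ℝ V] {E T A : Set V}
    (Φ : V ≃L[ℝ] ℂ) (hE : enclosed (Φ '' T) ⊆ Φ '' E) (hT : T ⊆ E)
    (hA : ∀ a ∈ A, ∀ b ∈ A, segment ℝ a b ⊆ E → segment ℝ a b ⊆ T) :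
    IsChordless (Φ '' T) (Φ '' A) := by
  have himage : ∀ a b, segment ℝ (Φ a) (Φ b) = Φ '' segment ℝ a b := fun a b =>
    (image_segment ℝ (Φ : V →ₗ[ℝ] ℂ).toAffineMap a b).symm
  rintro _ ⟨a, ha, rfl⟩ _ ⟨b, hb, rfl⟩ hab
  rw [himage] at hab ⊢
  refine image_mono (hA a ha b hb fun w hw => ?_)
  rcases hab (mem_image_of_mem _ hw) with h | h
  · obtain ⟨w', hw', heq⟩ := hE h
    exact Φ.injective heq ▸ hw'
  · obtain ⟨w', hw', heq⟩ := h
    exact hT (Φ.injective heq ▸ hw')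

/-- If a simple closed curve is the union of three arcs whose chords in `E` never leave the curve,
an arc that meets a line in three points follows the line between them. -/
theorem IsLoop.im_eq_of_chordless {V : Type*} [NormedAddCommGroup V] [NormedSpace ℝ V]
    {Ψ : ℝ → V} (h : IsLoop Ψ) {E : Set V} (hTE : range Ψ ⊆ E)
    (hE : ∀ Φ : V ≃L[ℝ] ℂ, enclosed (Φ '' range Ψ) ⊆ Φ '' E) {α₀ α₁ m : ℝ}
    (hα : α₁ < α₀ + 2 * Real.pi)
    (hA : ∀ a ∈ Ψ '' Icc α₀ α₁, ∀ b ∈ Ψ '' Icc α₀ α₁,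
      segment ℝ a b ⊆ E → segment ℝ a b ⊆ range Ψ)
    (hC : ∀ a ∈ Ψ '' Icc α₁ m, ∀ b ∈ Ψ '' Icc α₁ m,
      segment ℝ a b ⊆ E → segment ℝ a b ⊆ range Ψ)
    (hB : ∀ a ∈ Ψ '' Icc m (α₀ + 2 * Real.pi), ∀ b ∈ Ψ '' Icc m (α₀ + 2 * Real.pi),
      segment ℝ a b ⊆ E → segment ℝ a b ⊆ range Ψ)
    (Φ₀ : V ≃L[ℝ] ℂ) {c s₁ s₂ s₃ : ℝ} (hs₁ : α₀ ≤ s₁) (hs₁₂ : s₁ < s₂) (hs₂₃ : s₂ < s₃)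
    (hs₃ : s₃ ≤ α₁) (h₁ : (Φ₀ (Ψ s₁)).im = c) (h₂ : (Φ₀ (Ψ s₂)).im = c)
    (h₃ : (Φ₀ (Ψ s₃)).im = c) : ∀ s ∈ Icc s₁ s₃, (Φ₀ (Ψ s)).im = c := by
  intro s hs
  by_contra hne
  have hinj := h.injOn_Icc hα
  have hcont : Continuous fun s => Φ₀ (Ψ s) := Φ₀.continuous.comp h.continuous
  have hsub : Icc s₁ s₃ ⊆ Icc α₀ α₁ := Icc_subset_Icc hs₁ hs₃
  obtain ⟨θ, e₁, he₁, e₂, he₂, hee, hext₁, hext₂⟩ := exists_two_extrema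
    (x := fun s => (Φ₀ (Ψ s)).re) (y := fun s => (Φ₀ (Ψ s)).im - c)
    (Complex.continuous_re.comp hcont) ((Complex.continuous_im.comp hcont).sub continuous_const)
    (fun r hr t ht hx hy => hinj (hsub hr) (hsub ht)
      (Φ₀.injective (Complex.ext hx (sub_left_injective hy)))) hs₁₂ hs₂₃
    (sub_eq_zero.2 h₁) (sub_eq_zero.2 h₂) (sub_eq_zero.2 h₃) hs (sub_ne_zero.2 hne)
  set Φ : V ≃L[ℝ] ℂ := Φ₀.trans (Complex.shear θ) with hΦ
  have hΨ : IsLoop (Φ ∘ Ψ) := h.comp Φ.continuous Φ.injective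
  have him : ∀ r, ((Φ ∘ Ψ) r).im = (Φ₀ (Ψ r)).im + θ * (Φ₀ (Ψ r)).re := fun r =>
    Complex.im_shear θ _
  have hext : ∀ e, IsStrictLocalExtr (fun r => (Φ₀ (Ψ r)).im - c + θ * (Φ₀ (Ψ r)).re) e →
      IsStrictLocalExtr (fun r => ((Φ ∘ Ψ) r).im) e := by
    rintro e ⟨ε, hε, η, hη, hlt⟩
    refine ⟨ε, hε, η, hη, fun r hr hre => ?_⟩
    have := hlt r hr hre
    simp only [him]
    linarith
  have key : ∀ e e', e < e' → e ∈ Ioo s₁ s₃ → e' ∈ Ioo s₁ s₃ →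
      IsStrictLocalExtr (fun r => ((Φ ∘ Ψ) r).im) e →
      IsStrictLocalExtr (fun r => ((Φ ∘ Ψ) r).im) e' → False := by
    intro e e' hlt he he' hx hx'
    have hmem : ∀ r ∈ Ioo s₁ s₃, r ∈ Ioo α₀ α₁ := fun r hr =>
      ⟨by linarith [hr.1], by linarith [hr.2]⟩
    have hnon : (enclosed (range (Φ ∘ Ψ))).Nonempty := by
      obtain ⟨ε, -, η, hη, hlt⟩ := hx
      refine hΨ.nonempty_enclosed (x := e + η / 2) (y := e) fun heq => ?_
      have := hlt (e + η / 2) (by rw [add_sub_cancel_left, abs_of_pos] <;> linarith) (by linarith)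
      simp only [heq, lt_irrefl] at this
    have hch : ∀ I : Set ℝ, (∀ a ∈ Ψ '' I, ∀ b ∈ Ψ '' I,
        segment ℝ a b ⊆ E → segment ℝ a b ⊆ range Ψ) →
        IsChordless (range (Φ ∘ Ψ)) ((Φ ∘ Ψ) '' I) := fun I hI => by
      rw [range_comp, image_comp]
      exact isChordless_image Φ (hE Φ) hTE hI
    exact hΨ.not_two_strict_extrema hnon (hmem e he) (hmem e' he') hlt hα (hch _ hA) (hch _ hC)
      (hch _ hB) (hΨ.isStrictExtremum hx) (hΨ.isStrictExtremum hx')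
  rcases lt_or_gt_of_ne hee with hlt | hlt
  · exact key _ _ hlt he₁ he₂ (hext _ hext₁) (hext _ hext₂)
  · exact key _ _ hlt he₂ he₁ (hext _ hext₂) (hext _ hext₁)

theorem edist_le_pathEDist {X : Type*} [PseudoEMetricSpace X] (x y : X) :
    edist x y ≤ pathEDist x y := by
  refine le_iInf fun c => ?_
  have := eVariationOn.edist_le (fun t => c t) (mem_univ (0 : unitInterval)) (mem_univ 1)
  rwa [c.source, c.target] at this

theorem pathEDist_self {X : Type*} [PseudoEMetricSpace X] (x : X) : pathEDist x x = 0 := by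
  refine le_antisymm ((iInf_le _ (Path.refl x)).trans ?_) bot_le
  refine (eVariationOn.constant_on ?_).le
  rintro _ ⟨s, -, rfl⟩ _ ⟨t, -, rfl⟩
  simp

theorem pathEDist_le_edist_of_segment_subset {V : Type*} [NormedAddCommGroup V] [NormedSpace ℝ V]
    {E : Set V} {a b : E} (h : segment ℝ (a : V) b ⊆ E) : pathEDist a b ≤ edist (a : V) b := by
  have hmem : ∀ t : unitInterval, AffineMap.lineMap (a : V) (b : V) (t : ℝ) ∈ E := fun t =>
    h (segment_eq_image_lineMap ℝ (a : V) b ▸ mem_image_of_mem _ t.2)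
  let c : Path a b :=
    { toFun := fun t => ⟨AffineMap.lineMap (a : V) (b : V) (t : ℝ), hmem t⟩
      continuous_toFun := (AffineMap.lineMap_continuous.comp continuous_subtype_val).subtype_mk _
      source' := by simp
      target' := by simp }
  refine (iInf_le _ c).trans ?_
  have hlip : LipschitzOnWith (nndist (a : V) b) (AffineMap.lineMap (a : V) (b : V) : ℝ → V) univ :=
    (lipschitzWith_lineMap (a : V) b).lipschitzOnWith
  have hvar : eVariationOn (Subtype.val : unitInterval → ℝ) univ ≤ 1 := by
    have := MonotoneOn.eVariationOn_eq (f := (Subtype.val : unitInterval → ℝ)) (s := univ)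
      (a := 0) (b := 1) (fun x _ y _ hxy => hxy) (mem_univ _) (mem_univ _)
    rw [show (univ : Set unitInterval) ∩ Icc 0 1 = univ by
      ext x; simp [unitInterval.le_one']] at this
    simp [this]
  calc pathLength c = eVariationOn
        ((AffineMap.lineMap (a : V) (b : V) : ℝ → V) ∘ (Subtype.val : unitInterval → ℝ)) univ := rfl
    _ ≤ nndist (a : V) b * eVariationOn (Subtype.val : unitInterval → ℝ) univ :=
        hlip.comp_eVariationOn_le (mapsTo_univ _ _)
    _ ≤ nndist (a : V) b * 1 := by gcongr
    _ = edist (a : V) b := by rw [mul_one, edist_nndist]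

theorem image_comp_sub_Icc {Y : Type*} (f : ℝ → Y) (D : ℝ) :
    (fun t => f (D - t)) '' Icc 0 D = f '' Icc 0 D := by
  rw [← Function.comp_def f, image_comp, image_const_sub_Icc, sub_self, sub_zero]

namespace IsGeodesicSegment

section

variable {X : Type*} [MetricSpace X] {γ : ℝ → X} {D : ℝ} {x y : X}

theorem lipschitzOnWith (h : IsGeodesicSegment γ D x y) : LipschitzOnWith 1 γ (Icc 0 D) := by
  intro s hs t ht
  rw [ENNReal.coe_one, one_mul, edist_dist s t, Real.dist_eq, ← h.2.2 s hs t ht]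
  exact edist_le_pathEDist _ _

theorem injOn (h : IsGeodesicSegment γ D x y) : InjOn γ (Icc 0 D) := by
  intro s hs t ht hst
  have := h.2.2 s hs t ht
  rw [hst, pathEDist_self, eq_comm, ENNReal.ofReal_eq_zero] at this
  exact sub_eq_zero.1 (abs_nonpos_iff.1 this)

theorem reverse (h : IsGeodesicSegment γ D x y) : IsGeodesicSegment (fun t => γ (D - t)) D y x := by
  refine ⟨by simpa using h.2.1, by simpa using h.1, fun s hs t ht => ?_⟩
  rw [h.2.2 _ ⟨by linarith [hs.2], by linarith [hs.1]⟩ _ ⟨by linarith [ht.2], by linarith [ht.1]⟩,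
    sub_sub_sub_cancel_left, abs_sub_comm]

theorem left_mem_image (h : IsGeodesicSegment γ D x y) (hD : 0 ≤ D) {Y : Type*} (f : X → Y) :
    f x ∈ (f ∘ γ) '' Icc 0 D := ⟨0, ⟨le_rfl, hD⟩, congrArg f h.1⟩

theorem pathEDist_eq (h : IsGeodesicSegment γ D x y) (hD : 0 ≤ D) :
    pathEDist x y = ENNReal.ofReal D := by
  have := h.2.2 0 ⟨le_rfl, hD⟩ D ⟨hD, le_rfl⟩
  rwa [h.1, h.2.1, zero_sub, abs_neg, abs_of_nonneg hD] at this

/-- Two sides of a geodesic triangle cannot each contain the far endpoint of a third,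
nontrivial side. -/
theorem not_mem_and_mem {γ₁ γ₂ γ₃ : ℝ → X} {a b c : ℝ} {u v w : X}
    (hA : IsGeodesicSegment γ₁ a u v) (hB : IsGeodesicSegment γ₂ b u w)
    (hC : IsGeodesicSegment γ₃ c v w) (ha : 0 < a) (hb : 0 ≤ b) (hc : 0 ≤ c) :
    ¬ (u ∈ γ₃ '' Icc 0 c ∧ v ∈ γ₂ '' Icc 0 b) := by
  rintro ⟨⟨t, ht, htu⟩, s, hs, hsv⟩
  have e₁ := hC.2.2 0 ⟨le_rfl, hc⟩ t ht
  have e₂ := hC.2.2 t ht c ⟨hc, le_rfl⟩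
  have e₃ := hB.2.2 0 ⟨le_rfl, hb⟩ s hs
  have e₄ := hB.2.2 s hs b ⟨hb, le_rfl⟩
  rw [htu, hC.1, hA.reverse.pathEDist_eq ha.le, zero_sub, abs_neg, abs_of_nonneg ht.1,
    ENNReal.ofReal_eq_ofReal_iff ha.le ht.1] at e₁
  rw [htu, hC.2.1, hB.pathEDist_eq hb, abs_sub_comm, abs_of_nonneg (sub_nonneg.2 ht.2),
    ENNReal.ofReal_eq_ofReal_iff hb (sub_nonneg.2 ht.2)] at e₂
  rw [hsv, hB.1, hA.pathEDist_eq ha.le, zero_sub, abs_neg, abs_of_nonneg hs.1,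
    ENNReal.ofReal_eq_ofReal_iff ha.le hs.1] at e₃
  rw [hsv, hB.2.1, hC.pathEDist_eq hc, abs_sub_comm, abs_of_nonneg (sub_nonneg.2 hs.2),
    ENNReal.ofReal_eq_ofReal_iff hc (sub_nonneg.2 hs.2)] at e₄
  linarith

end

section

variable {V : Type*} [NormedAddCommGroup V] [NormedSpace ℝ V] [StrictConvexSpace ℝ V]
  {E : Set V} {γ : ℝ → E} {D : ℝ} {x y : E}

/-- A geodesic is straight between two points joined by a segment inside `E`. -/
theorem eq_lineMap (h : IsGeodesicSegment γ D x y) {s t u : ℝ} (hs : 0 ≤ s) (hu : u ≤ D)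
    (ht : t ∈ Icc s u) (hsu : s < u) (hseg : segment ℝ (γ s : V) (γ u) ⊆ E) :
    (γ t : V) = AffineMap.lineMap (γ s : V) (γ u : V) ((t - s) / (u - s)) := by
  have ms : s ∈ Icc 0 D := ⟨hs, hsu.le.trans hu⟩
  have mt : t ∈ Icc 0 D := ⟨hs.trans ht.1, ht.2.trans hu⟩
  have mu : u ∈ Icc 0 D := ⟨hs.trans hsu.le, hu⟩
  have d₁ : dist (γ s : V) (γ t) ≤ t - s := by
    have := h.lipschitzOnWith.dist_le_mul s ms t mt
    rwa [NNReal.coe_one, one_mul, dist_comm s, Real.dist_eq, abs_of_nonneg (by linarith [ht.1])]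
      at this
  have d₂ : dist (γ t : V) (γ u) ≤ u - t := by
    have := h.lipschitzOnWith.dist_le_mul t mt u mu
    rwa [NNReal.coe_one, one_mul, dist_comm t, Real.dist_eq, abs_of_nonneg (by linarith [ht.2])]
      at this
  have d₃ : dist (γ s : V) (γ u) = u - s := by
    refine le_antisymm ((dist_triangle _ (γ t : V) _).trans (by linarith)) ?_
    have h1 := pathEDist_le_edist_of_segment_subset hseg
    rw [h.2.2 s ms u mu, edist_dist, abs_sub_comm, abs_of_pos (sub_pos.2 hsu)] at h1
    exact (ENNReal.ofReal_le_ofReal_iff dist_nonneg).1 h1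
  have d₄ := dist_triangle (γ s : V) (γ t) (γ u)
  have hpos : u - s ≠ 0 := (sub_pos.2 hsu).ne'
  refine eq_lineMap_of_dist_eq_mul_of_dist_eq_mul ?_ ?_
  · rw [d₃, div_mul_cancel₀ _ hpos]; linarith
  · rw [d₃, sub_mul, div_mul_cancel₀ _ hpos]; linarith

theorem image_Icc_eq_segment (h : IsGeodesicSegment γ D x y) {s u : ℝ} (hs : 0 ≤ s) (hu : u ≤ D)
    (hsu : s ≤ u) (hseg : segment ℝ (γ s : V) (γ u) ⊆ E) :
    (Subtype.val ∘ γ) '' Icc s u = segment ℝ (γ s : V) (γ u) := by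
  rcases hsu.eq_or_lt with rfl | hsu
  · simp
  rw [segment_eq_image_lineMap]
  have hpos := sub_pos.2 hsu
  ext w
  constructor
  · rintro ⟨t, ht, rfl⟩
    exact ⟨_, ⟨div_nonneg (by linarith [ht.1]) hpos.le,
      (div_le_one hpos).2 (by linarith [ht.2])⟩, (h.eq_lineMap hs hu ht hsu hseg).symm⟩
  · rintro ⟨r, hr, rfl⟩
    refine ⟨s + r * (u - s), ⟨by nlinarith [hr.1], by nlinarith [hr.2]⟩, ?_⟩
    rw [Function.comp_apply,
      h.eq_lineMap hs hu ⟨by nlinarith [hr.1], by nlinarith [hr.2]⟩ hsu hseg, add_sub_cancel_left,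
      mul_div_cancel_right₀ _ hpos.ne']

theorem segment_subset_image (h : IsGeodesicSegment γ D x y) {a b : V}
    (ha : a ∈ (Subtype.val ∘ γ) '' Icc 0 D) (hb : b ∈ (Subtype.val ∘ γ) '' Icc 0 D)
    (hab : segment ℝ a b ⊆ E) : segment ℝ a b ⊆ (Subtype.val ∘ γ) '' Icc 0 D := by
  obtain ⟨s, hs, rfl⟩ := ha
  obtain ⟨u, hu, rfl⟩ := hb
  wlog hsu : s ≤ u generalizing s u
  · rw [segment_symm] at hab ⊢
    exact this u hu s hs hab (le_of_not_ge hsu)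
  rw [Function.comp_apply, Function.comp_apply, ← h.image_Icc_eq_segment hs.1 hu.2 hsu hab]
  exact image_mono (Icc_subset_Icc hs.1 hu.2)

end

end IsGeodesicSegment

namespace IsLoop

theorem exists_of_sphere {X : Type*} [TopologicalSpace X]
    {φ : Metric.sphere (0 : EuclideanSpace ℝ (Fin 2)) 1 → X} (hφ : Continuous φ)
    (hφ' : Function.Injective φ) : ∃ Ψ : ℝ → X, IsLoop Ψ ∧
      ∀ p : Metric.sphere (0 : EuclideanSpace ℝ (Fin 2)) 1, ∀ s : ℝ,
        (p.1 0 + p.1 1 * Complex.I : ℂ) = Complex.exp (s * Complex.I) → Ψ s = φ p := by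
  have hmem : ∀ s : ℝ, !₂[Real.cos s, Real.sin s] ∈
      Metric.sphere (0 : EuclideanSpace ℝ (Fin 2)) 1 := fun s => by
    simp [EuclideanSpace.norm_eq]
  refine ⟨fun s => φ ⟨_, hmem s⟩, ⟨hφ.comp (Continuous.subtype_mk ?_ _), fun s => ?_, ?_⟩, ?_⟩
  · fun_prop
  · simp
  · intro x y hxy
    have h := congrArg Subtype.val (hφ' hxy)
    have h0 := congrArg (fun v : EuclideanSpace ℝ (Fin 2) => v 0) h
    have h1 := congrArg (fun v : EuclideanSpace ℝ (Fin 2) => v 1) h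
    obtain ⟨n, hn⟩ := Real.Angle.angle_eq_iff_two_pi_dvd_sub.1
      (Real.Angle.cos_sin_inj (by simpa using h0) (by simpa using h1))
    exact ⟨n, hn.trans (mul_comm _ _)⟩
  · intro p s hps
    rw [Complex.exp_mul_I, ← Complex.ofReal_cos, ← Complex.ofReal_sin] at hps
    have h0 := congrArg Complex.re hps
    have h1 := congrArg Complex.im hps
    simp only [Complex.add_re, Complex.ofReal_re, Complex.mul_re, Complex.I_re, mul_zero,
      Complex.ofReal_im, Complex.I_im, mul_one, sub_self, add_zero, Complex.add_im, Complex.mul_im,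
      zero_add] at h0 h1
    refine congrArg φ (Subtype.ext ?_)
    ext i
    fin_cases i
    · exact h0.symm
    · exact h1.symm

/-- A simple closed curve can be parametrized so that a given simple arc on it is traversed
in increasing direction. -/
theorem exists_strictMonoOn_param {X : Type*} [TopologicalSpace X] [T2Space X]
    {φ : Metric.sphere (0 : EuclideanSpace ℝ (Fin 2)) 1 → X} (hφ : Continuous φ)
    (hφ' : Function.Injective φ) {γ : ℝ → X} {D : ℝ} (hD : 0 < D)
    (hγ : ContinuousOn γ (Icc 0 D)) (hγi : InjOn γ (Icc 0 D))
    (hγφ : γ '' Icc 0 D ⊆ range φ) :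
    ∃ Ψ : ℝ → X, IsLoop Ψ ∧ range Ψ = range φ ∧ ∃ g : ℝ → ℝ, ContinuousOn g (Icc 0 D) ∧
      StrictMonoOn g (Icc 0 D) ∧ (∀ t ∈ Icc 0 D, Ψ (g t) = γ t) ∧ g D < g 0 + 2 * Real.pi := by
  obtain ⟨Ψ, hΨ, hΨφ⟩ := exists_of_sphere hφ hφ'
  have hnorm : ∀ p : Metric.sphere (0 : EuclideanSpace ℝ (Fin 2)) 1,
      ‖(p.1 0 + p.1 1 * Complex.I : ℂ)‖ = 1 := fun p => by
    have := mem_sphere_zero_iff_norm.1 p.2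
    rw [EuclideanSpace.norm_eq, Fin.sum_univ_two, Real.norm_eq_abs, Real.norm_eq_abs, sq_abs,
      sq_abs] at this
    rwa [Complex.norm_add_mul_I]
  have hrange : range Ψ = range φ := by
    ext w
    constructor
    · rintro ⟨s, rfl⟩
      have hmem : !₂[Real.cos s, Real.sin s] ∈
          Metric.sphere (0 : EuclideanSpace ℝ (Fin 2)) 1 := by
        simp [EuclideanSpace.norm_eq]
      refine ⟨⟨_, hmem⟩, (hΨφ _ s ?_).symm⟩
      rw [Complex.exp_mul_I]
      simp
    · rintro ⟨p, rfl⟩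
      refine ⟨Complex.arg (p.1 0 + p.1 1 * Complex.I), hΨφ p _ ?_⟩
      have := Complex.norm_mul_exp_arg_mul_I (p.1 0 + p.1 1 * Complex.I : ℂ)
      rw [hnorm, Complex.ofReal_one, one_mul] at this
      exact this.symm
  let γ' : ℝ → X := fun t => γ (projIcc 0 D hD.le t)
  have hγ' : Continuous γ' := hγ.comp_continuous (by fun_prop) fun t => (projIcc 0 D hD.le t).2
  have hγ'eq : ∀ t ∈ Icc 0 D, γ' t = γ t := fun t ht => by simp only [γ', projIcc_of_mem _ ht]
  have hex : ∀ t, ∃ p, φ p = γ' t := fun t => hγφ ⟨_, (projIcc 0 D hD.le t).2, rfl⟩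
  choose f hf using hex
  have hfc : Continuous f := by
    rw [(hφ.isClosedEmbedding hφ').isEmbedding.continuous_iff]
    exact hγ'.congr fun t => (hf t).symm
  have hfz : Continuous fun t => ((f t).1 0 + (f t).1 1 * Complex.I : ℂ) := by fun_prop
  obtain ⟨l, hlc, hl⟩ := exists_log_on_Icc (a := 0) (b := D) (z := 0) hfz (by
    rintro ⟨t, -, ht⟩
    have := hnorm (f t)
    simp only at ht
    rw [ht, norm_zero] at this
    exact zero_ne_one this)
  have hl' : ∀ t ∈ Icc 0 D, Ψ (l t).im = γ t := fun t ht => by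
    rw [← hγ'eq t ht, ← hf]
    refine hΨφ _ _ ?_
    have h1 := hl t ht
    rw [sub_zero] at h1
    have h2 := congrArg norm h1
    rw [hnorm, Complex.norm_exp, Real.exp_eq_one_iff] at h2
    rw [← h1]
    congr 1
    apply Complex.ext <;> simp [h2]
  have hgc : ContinuousOn (fun t => (l t).im) (Icc 0 D) := Complex.continuous_im.comp_continuousOn hlc
  have hinj : InjOn (fun t => (l t).im) (Icc 0 D) := fun s hs t ht hst =>
    hγi hs ht (by rw [← hl' s hs, ← hl' t ht]; exact congrArg Ψ hst)
  obtain ⟨Ψ₁, hΨ₁, hr₁, g, hg, hmono, hgγ⟩ : ∃ Ψ₁ : ℝ → X, IsLoop Ψ₁ ∧ range Ψ₁ = range φ ∧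
      ∃ g : ℝ → ℝ, ContinuousOn g (Icc 0 D) ∧ StrictMonoOn g (Icc 0 D) ∧
        ∀ t ∈ Icc 0 D, Ψ₁ (g t) = γ t := by
    rcases hgc.strictMonoOn_of_injOn_Icc' hD.le hinj with hm | hm
    · exact ⟨Ψ, hΨ, hrange, _, hgc, hm, hl'⟩
    · refine ⟨_, hΨ.comp_neg, ?_, fun t => -(l t).im, hgc.neg, hm.neg, fun t ht => ?_⟩
      · rw [← hrange]; exact (Equiv.neg ℝ).surjective.range_comp Ψ
      · simpa using hl' t ht
  refine ⟨Ψ₁, hΨ₁, hr₁, g, hg, hmono, hgγ, not_le.1 fun hle => ?_⟩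
  have m₀ : (0 : ℝ) ∈ Icc 0 D := ⟨le_rfl, hD.le⟩
  obtain ⟨t, ht, hgt⟩ := intermediate_value_Icc hD.le hg
    ⟨by linarith [Real.two_pi_pos], hle⟩
  have : t = 0 := hγi ht m₀ (by rw [← hgγ t ht, ← hgγ 0 m₀, hgt]; exact hΨ₁.periodic _)
  rw [this] at hgt
  linarith [Real.two_pi_pos]

/-- An arc covered by two connected closed sets, one around each endpoint, neither of which
covers the opposite endpoint as well, splits into two pieces accordingly. -/
theorem exists_split {X : Type*} [TopologicalSpace X] [T2Space X] {Ψ : ℝ → X} (h : IsLoop Ψ)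
    {α β : ℝ} {B C : Set X} (hαβ : α ≤ β) (hβ : β < α + 2 * Real.pi) (hBC : IsClosed B)
    (hCC : IsClosed C) (hB : IsPreconnected B) (hC : IsPreconnected C) (hBT : B ⊆ range Ψ)
    (hCT : C ⊆ range Ψ) (hcov : Ψ '' Icc α β ⊆ B ∪ C) (hαC : Ψ α ∈ C) (hβB : Ψ β ∈ B)
    (hnot : ¬ (Ψ β ∈ C ∧ Ψ α ∈ B)) :
    ∃ m, Ψ '' Icc α m ⊆ C ∧ Ψ '' Icc m β ⊆ B := by
  set S := {x | x ∈ Icc α β ∧ Ψ '' Icc α x ⊆ C}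
  have hαS : α ∈ S := ⟨⟨le_rfl, hαβ⟩, by simpa using hαC⟩
  have hSb : BddAbove S := ⟨β, fun x hx => hx.1.2⟩
  have hm : sSup S ∈ Icc α β := ⟨le_csSup hSb hαS, csSup_le ⟨_, hαS⟩ fun x hx => hx.1.2⟩
  have hper : ∀ x, Ψ (x + 2 * Real.pi) = Ψ x := h.periodic
  have hIoo : ∀ x ∈ Ico α (sSup S), Ψ x ∈ C := fun x hx => by
    obtain ⟨s, hs, hxs⟩ := exists_lt_of_lt_csSup ⟨_, hαS⟩ hx.2
    exact hs.2 ⟨x, ⟨hx.1, hxs.le⟩, rfl⟩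
  have hIcc : ∀ x ∈ Icc α (sSup S), Ψ x ∈ C := by
    rcases hm.1.eq_or_lt with heq | hlt
    · rw [← heq]; simpa using hαC
    · rw [← closure_Ico hlt.ne]
      exact (show MapsTo Ψ (Ico α (sSup S)) C from hIoo).closure_left h.continuous hCC
  have hIoc : ∀ y ∈ Ioc (sSup S) β, Ψ y ∈ B := by
    intro y hy
    by_contra hyB
    have hαy := hm.1.trans_lt hy.1
    have hyC : Ψ y ∈ C := (hcov ⟨y, ⟨hαy.le, hy.2⟩, rfl⟩).resolve_left hyB
    obtain ⟨x, hx, hxC⟩ : ∃ x ∈ Icc α y, Ψ x ∉ C := by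
      by_contra! hcon
      exact (le_csSup hSb ⟨⟨hαy.le, hy.2⟩, image_subset_iff.2 hcon⟩).not_gt hy.1
    have hxB : Ψ x ∈ B := (hcov ⟨x, ⟨hx.1, hx.2.trans hy.2⟩, rfl⟩).resolve_right hxC
    refine hnot ⟨?_, ?_⟩
    · refine (h.isPreconnected_meets (hx.2.trans hy.2) (by linarith [hx.1]) hC hCT
        ⟨_, hyC, y, ⟨hx.2, hy.2⟩, rfl⟩
        ⟨_, hαC, α + 2 * Real.pi, ⟨hβ.le, by linarith [hx.1]⟩, hper α⟩).resolve_left hxC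
    · rw [← hper]
      exact (h.isPreconnected_meets (a := y) (b := α + 2 * Real.pi) (hy.2.trans hβ.le)
        (by linarith) hB hBT ⟨_, hβB, β, ⟨hy.2, hβ.le⟩, rfl⟩
        ⟨_, hxB, x + 2 * Real.pi, ⟨by linarith [hx.1], by linarith [hx.2]⟩, hper x⟩).resolve_left hyB
  refine ⟨sSup S, image_subset_iff.2 hIcc, image_subset_iff.2 ?_⟩
  rcases hm.2.eq_or_lt with heq | hlt
  · rw [heq]; simpa using hβB
  · rw [← closure_Ioc hlt.ne]
    exact (show MapsTo Ψ (Ioc (sSup S) β) B from hIoc).closure_left h.continuous hBC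

end IsLoop

theorem enclosed_image_subset_of_simplyConnected {V : Type*} [NormedAddCommGroup V]
    [NormedSpace ℝ V] {E : Set V} (hE : SimplyConnectedSpace E) {Ψ : ℝ → V} (h : IsLoop Ψ)
    (hΨE : range Ψ ⊆ E) (Φ : V ≃L[ℝ] ℂ) : enclosed (Φ '' range Ψ) ⊆ Φ '' E := by
  rintro z ⟨-, hz⟩
  by_contra hzE
  refine hz ?_
  have hpi := Real.two_pi_pos
  have hne : ∀ x : E, Φ x - z ≠ 0 := fun x hx => hzE ⟨x, x.2, sub_eq_zero.1 hx⟩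
  let F : C(E, {w : ℂ // w ≠ 0}) :=
    ⟨fun x => ⟨Φ x - z, hne x⟩, by
      exact ((Φ.continuous.comp continuous_subtype_val).sub continuous_const).subtype_mk _⟩
  let x₀ : E := ⟨Ψ 0, hΨE (mem_range_self 0)⟩
  let p : Path x₀ x₀ :=
    { toFun := fun t => ⟨Ψ (2 * Real.pi * t), hΨE (mem_range_self _)⟩
      continuous_toFun := (h.continuous.comp (by fun_prop)).subtype_mk _
      source' := by simp [x₀]
      target' := by simpa [x₀] using h.periodic 0 }
  have hhom : (p.map F.continuous).Homotopic ((Path.refl x₀).map F.continuous) :=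
    (SimplyConnectedSpace.paths_homotopic p (Path.refl x₀)).map F
  let e : ℂ := Complex.log (F x₀)
  have he : F x₀ = ⟨Complex.exp e, Complex.exp_ne_zero e⟩ :=
    Subtype.ext (Complex.exp_log (F x₀).2).symm
  have cov := Complex.isCoveringMap_exp
  have h₀ : (p.map F.continuous).toContinuousMap 0 = ⟨Complex.exp e, Complex.exp_ne_zero e⟩ :=
    (p.map F.continuous).source.trans he
  have h₁ : ((Path.refl x₀).map F.continuous).toContinuousMap 0 =
      ⟨Complex.exp e, Complex.exp_ne_zero e⟩ :=
    ((Path.refl x₀).map F.continuous).source.trans he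
  let l := cov.liftPath _ e h₀
  have hl₀ : l 0 = e := cov.liftPath_zero _ e h₀
  have hl₁ : l 1 = e :=
    (cov.liftPath_apply_one_eq_of_homotopicRel hhom e h₀ h₁).trans
      (congrArg (fun f : C(unitInterval, ℂ) => f 1) (cov.liftPath_const he))
  have hl : ∀ t, Complex.exp (l t) = Φ (Ψ (2 * Real.pi * t)) - z := fun t =>
    congrArg Subtype.val (congrFun (cov.liftPath_lifts _ e h₀) t)
  let g : ℝ → ℂ := fun s => l (projIcc 0 1 zero_le_one (s / (2 * Real.pi)))
  have hg : ∀ s ∈ Icc 0 (2 * Real.pi), ∃ t : unitInterval, g s = l t ∧ 2 * Real.pi * t = s := by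
    intro s hs
    have hs' : s / (2 * Real.pi) ∈ Icc (0 : ℝ) 1 := ⟨div_nonneg hs.1 hpi.le, (div_le_one hpi).2 hs.2⟩
    exact ⟨⟨_, hs'⟩, by simp only [g, projIcc_of_mem _ hs'], mul_div_cancel₀ s hpi.ne'⟩
  have hg₀ : g 0 = e := by simp [g, hl₀]
  have hg₁ : g (2 * Real.pi) = e := by simp [g, hl₁]
  have hgc : Continuous g := l.continuous.comp (continuous_projIcc.comp (by fun_prop))
  have key := hasLog_image_Icc (Ψ := Φ ∘ Ψ) (z := z) (a := 0) (b := 2 * Real.pi)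
    (Φ.continuous.comp h.continuous) hgc.continuousOn
    (fun s hs => by
      obtain ⟨t, ht, hts⟩ := hg s hs
      rw [ht, hl, hts, Function.comp_apply]) fun s hs t ht hst => ?_
  · rwa [image_comp, ← zero_add (2 * Real.pi), ← h.range_eq_image_Icc] at key
  · wlog hle : s ≤ t generalizing s t
    · exact (this t ht s hs hst.symm (le_of_not_ge hle)).symm
    by_cases hlt : t - s < 2 * Real.pi
    · rw [h.eq_of_abs_sub_lt (Φ.injective hst) (by rw [abs_lt]; constructor <;> linarith)]
    · rw [show s = 0 by linarith [hs.1, ht.2], show t = 2 * Real.pi by linarith [hs.1, ht.2], hg₀,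
        hg₁]

theorem exists_equiv_im_eq {p q : EuclideanSpace ℝ (Fin 2)} (hpq : p ≠ q) :
    ∃ Φ : EuclideanSpace ℝ (Fin 2) ≃L[ℝ] ℂ, (Φ p).im = (Φ q).im := by
  let Φ₁ : EuclideanSpace ℝ (Fin 2) ≃L[ℝ] ℂ :=
    Complex.orthonormalBasisOneI.repr.symm.toContinuousLinearEquiv
  have hd : Φ₁ p - Φ₁ q ≠ 0 := sub_ne_zero.2 (Φ₁.injective.ne hpq)
  let Φ₂ : ℂ ≃L[ℝ] ℂ :=
    (DistribMulAction.toLinearEquiv ℝ ℂ (Units.mk0 _ hd)⁻¹).toContinuousLinearEquiv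
  refine ⟨Φ₁.trans Φ₂, sub_eq_zero.1 ?_⟩
  have h : Φ₂ (Φ₁ p - Φ₁ q) = 1 := inv_mul_cancel₀ hd
  rw [← Complex.sub_im, ← map_sub, ContinuousLinearEquiv.trans_apply, map_sub, h, Complex.one_im]

theorem segment_subset_image_Icc_of_im_eq {V : Type*} [NormedAddCommGroup V] [NormedSpace ℝ V]
    (Φ : V ≃L[ℝ] ℂ) {γ : ℝ → V} {s u c : ℝ} (hsu : s ≤ u) (hγ : ContinuousOn γ (Icc s u))
    (him : ∀ t ∈ Icc s u, (Φ (γ t)).im = c) : segment ℝ (γ s) (γ u) ⊆ γ '' Icc s u := by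
  rintro w ⟨a, b, ha, hb, hab, rfl⟩
  have hcont : ContinuousOn (fun t => (Φ (γ t)).re) (uIcc s u) := by
    rw [uIcc_of_le hsu]
    exact Complex.continuous_re.comp_continuousOn (Φ.continuous.comp_continuousOn hγ)
  have hmem : (Φ (a • γ s + b • γ u)).re ∈ uIcc (Φ (γ s)).re (Φ (γ u)).re := by
    rw [← segment_eq_uIcc]
    exact ⟨a, b, ha, hb, hab, by simp⟩
  obtain ⟨t, ht, hre⟩ := intermediate_value_uIcc hcont hmem
  rw [uIcc_of_le hsu] at ht
  refine ⟨t, ht, Φ.injective (Complex.ext hre ?_)⟩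
  have h₁ := him s ⟨le_rfl, hsu⟩
  have h₂ := him u ⟨hsu, le_rfl⟩
  rw [him t ht]
  simp only [map_add, map_smul, Complex.add_im, Complex.smul_im, smul_eq_mul, h₁, h₂]
  rw [← add_mul, hab, one_mul]

namespace IsGeodesicSegment

section

variable {V : Type*} [NormedAddCommGroup V] [NormedSpace ℝ V] [StrictConvexSpace ℝ V]
  {E : Set V} {γ γ₂ γ₃ : ℝ → E} {a b c : ℝ} {u v w : E}

/-- A side of a simple geodesic triangle that meets a line in three points follows the line
between them. -/
theorem im_eq_of_triangle (hE : SimplyConnectedSpace E) (hA : IsGeodesicSegment γ a u v)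
    (hB : IsGeodesicSegment γ₂ b u w) (hC : IsGeodesicSegment γ₃ c v w) (hb : 0 ≤ b) (hc : 0 ≤ c)
    (hT : IsSimpleClosedCurve ((Subtype.val ∘ γ) '' Icc 0 a ∪ (Subtype.val ∘ γ₂) '' Icc 0 b ∪
      (Subtype.val ∘ γ₃) '' Icc 0 c)) (Φ : V ≃L[ℝ] ℂ) {k s₁ s₂ s₃ : ℝ} (hs₁ : 0 ≤ s₁)
    (hs₁₂ : s₁ < s₂) (hs₂₃ : s₂ < s₃) (hs₃ : s₃ ≤ a) (h₁ : (Φ (γ s₁)).im = k)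
    (h₂ : (Φ (γ s₂)).im = k) (h₃ : (Φ (γ s₃)).im = k) :
    ∀ s ∈ Icc s₁ s₃, (Φ (γ s)).im = k := by
  have ha : 0 < a := by linarith
  have hcont : ∀ {δ : ℝ → E} {d : ℝ} {x y : E}, IsGeodesicSegment δ d x y →
      ContinuousOn (Subtype.val ∘ δ) (Icc 0 d) := fun h =>
    continuous_subtype_val.comp_continuousOn h.lipschitzOnWith.continuousOn
  set A := (Subtype.val ∘ γ) '' Icc 0 a
  set B := (Subtype.val ∘ γ₂) '' Icc 0 b
  set C := (Subtype.val ∘ γ₃) '' Icc 0 c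
  obtain ⟨φ, hφ, hφ', hφT⟩ := hT
  obtain ⟨Ψ, hΨ, hΨφ, g, hg, hgm, hΨg, hga⟩ := IsLoop.exists_strictMonoOn_param hφ hφ' ha
    (hcont hA) (Subtype.val_injective.comp_injOn hA.injOn)
    (hφT ▸ subset_union_left.trans subset_union_left)
  rw [hφT] at hΨφ
  have m₀ : (0 : ℝ) ∈ Icc 0 a := ⟨le_rfl, ha.le⟩
  have m₁ : a ∈ Icc 0 a := ⟨ha.le, le_rfl⟩
  have hg01 : g 0 < g a := hgm m₀ m₁ ha
  have hgA : Ψ '' Icc (g 0) (g a) = A := by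
    have : g '' Icc 0 a = Icc (g 0) (g a) :=
      Subset.antisymm (image_subset_iff.2 fun t ht =>
        ⟨hgm.monotoneOn m₀ ht ht.1, hgm.monotoneOn ht m₁ ht.2⟩) (intermediate_value_Icc ha.le hg)
    rw [← this, ← image_comp]
    exact image_congr hΨg
  have hu : Ψ (g 0) = u := (hΨg 0 m₀).trans (congrArg Subtype.val hA.1)
  have hv : Ψ (g a) = v := (hΨg a m₁).trans (congrArg Subtype.val hA.2.1)
  have hu' : Ψ (g 0 + 2 * Real.pi) = u := (hΨ.periodic _).trans hu
  have huB : (u : V) ∈ B := hB.left_mem_image hb _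
  have hvC : (v : V) ∈ C := hC.left_mem_image hc _
  have hAT : A ⊆ range Ψ := hΨφ ▸ subset_union_left.trans subset_union_left
  have hBT : B ⊆ range Ψ := hΨφ ▸ subset_union_right.trans subset_union_left
  have hCT : C ⊆ range Ψ := hΨφ ▸ subset_union_right
  have hclosed : ∀ {δ : ℝ → E} {d : ℝ} {x y : E}, IsGeodesicSegment δ d x y →
      IsClosed ((Subtype.val ∘ δ) '' Icc 0 d) := fun h =>
    (isCompact_Icc.image_of_continuousOn (hcont h)).isClosed
  obtain ⟨m, hmC, hmB⟩ := hΨ.exists_split (α := g a) (β := g 0 + 2 * Real.pi) hga.le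
    (by linarith) (hclosed hB) (hclosed hC) (isPreconnected_Icc.image _ (hcont hB))
    (isPreconnected_Icc.image _ (hcont hC)) hBT hCT
    (by
      rintro _ ⟨x, hx, rfl⟩
      have hxT : Ψ x ∈ range Ψ := mem_range_self x
      rw [hΨφ] at hxT
      rcases hxT with (hxA | hxB) | hxC
      · rw [← hgA] at hxA
        rcases hΨ.inter_arcs ⟨hxA, mem_image_of_mem Ψ hx⟩ with h | h
        · rw [h, hu]; exact Or.inl huB
        · rw [h, hv]; exact Or.inr hvC
      · exact Or.inl hxB
      · exact Or.inr hxC)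
    (hv ▸ hvC) (hu' ▸ huB) (by
      rw [hu', hv]
      simp only [image_comp, Subtype.val_injective.mem_set_image]
      exact hA.not_mem_and_mem hB hC ha hb hc)
  have hTE : range Ψ ⊆ E := by
    rw [hΨφ]
    rintro _ ((⟨t, -, rfl⟩ | ⟨t, -, rfl⟩) | ⟨t, -, rfl⟩) <;> exact Subtype.coe_prop _
  intro s hs
  have mem : ∀ t, s₁ ≤ t → t ≤ s₃ → t ∈ Icc 0 a := fun t h h' => ⟨by linarith, by linarith⟩
  have n₁ := mem s₁ le_rfl (by linarith)
  have n₂ := mem s₂ hs₁₂.le hs₂₃.le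
  have n₃ := mem s₃ (by linarith) le_rfl
  have n := mem s hs.1 hs.2
  have key := hΨ.im_eq_of_chordless hTE
    (enclosed_image_subset_of_simplyConnected hE hΨ hTE) hga
    (fun p hp q hq h => (hA.segment_subset_image (hgA.subset hp) (hgA.subset hq) h).trans hAT)
    (fun p hp q hq h => (hC.segment_subset_image (hmC hp) (hmC hq) h).trans hCT)
    (fun p hp q hq h => (hB.segment_subset_image (hmB hp) (hmB hq) h).trans hBT)
    Φ (c := k) (hgm.monotoneOn m₀ n₁ hs₁) (hgm n₁ n₂ hs₁₂) (hgm n₂ n₃ hs₂₃)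
    (hgm.monotoneOn n₃ m₁ hs₃) (by rwa [hΨg _ n₁]) (by rwa [hΨg _ n₂]) (by rwa [hΨg _ n₃]) (g s)
    ⟨hgm.monotoneOn n₁ n hs.1, hgm.monotoneOn n n₃ hs.2⟩
  rwa [hΨg s n] at key

end

variable {E : Set (EuclideanSpace ℝ (Fin 2))} {γ γ₂ γ₃ : ℝ → E} {a b c : ℝ} {u v w : E}

theorem image_Icc_eq_segment_of_triangle (hE : SimplyConnectedSpace E)
    (hA : IsGeodesicSegment γ a u v) (hB : IsGeodesicSegment γ₂ b u w)
    (hC : IsGeodesicSegment γ₃ c v w) (hb : 0 ≤ b) (hc : 0 ≤ c)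
    (hT : IsSimpleClosedCurve ((Subtype.val ∘ γ) '' Icc 0 a ∪ (Subtype.val ∘ γ₂) '' Icc 0 b ∪
      (Subtype.val ∘ γ₃) '' Icc 0 c)) {t₁ t₂ t₃ : ℝ} (ht₁ : t₁ ∈ Icc 0 a) (ht₂ : t₂ ∈ Icc 0 a)
    (ht₃ : t₃ ∈ Icc 0 a) (h₁₃ : t₁ < t₃)
    (hbtw : Sbtw ℝ (γ t₁ : EuclideanSpace ℝ (Fin 2)) (γ t₂) (γ t₃)) :
    (Subtype.val ∘ γ) '' Icc t₁ t₃ =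
      segment ℝ (γ t₁ : EuclideanSpace ℝ (Fin 2)) (γ t₃) := by
  obtain ⟨Φ, hΦ⟩ := exists_equiv_im_eq hbtw.left_ne_right
  have him₂ : (Φ (γ t₂)).im = (Φ (γ t₁)).im := by
    obtain ⟨x, y, -, -, hxy, h⟩ := mem_segment_iff_wbtw.2 hbtw.wbtw
    rw [← h]
    simp only [map_add, map_smul, Complex.add_im, Complex.smul_im, smul_eq_mul, ← hΦ]
    rw [← add_mul, hxy, one_mul]
  have straight : ∀ s₁ s₂ s₃, 0 ≤ s₁ → s₁ < s₂ → s₂ < s₃ → s₃ ≤ a →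
      (Φ (γ s₁)).im = (Φ (γ t₁)).im → (Φ (γ s₂)).im = (Φ (γ t₁)).im →
      (Φ (γ s₃)).im = (Φ (γ t₁)).im →
      (Subtype.val ∘ γ) '' Icc s₁ s₃ = segment ℝ (γ s₁ : EuclideanSpace ℝ (Fin 2)) (γ s₃) := by
    intro s₁ s₂ s₃ hs₁ hs₁₂ hs₂₃ hs₃ e₁ e₂ e₃
    have hle := (hs₁₂.trans hs₂₃).le
    have hline := hA.im_eq_of_triangle hE hB hC hb hc hT Φ hs₁ hs₁₂ hs₂₃ hs₃ e₁ e₂ e₃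
    refine hA.image_Icc_eq_segment hs₁ hs₃ hle ((segment_subset_image_Icc_of_im_eq Φ
      (γ := Subtype.val ∘ γ) hle ?_ hline).trans ?_)
    · exact (continuous_subtype_val.comp_continuousOn hA.lipschitzOnWith.continuousOn).mono
        (Icc_subset_Icc hs₁ hs₃)
    · rintro _ ⟨t, -, rfl⟩
      exact (γ t).2
  rcases lt_trichotomy t₂ t₁ with h | h | h
  · have heq := straight t₂ t₁ t₃ ht₂.1 h h₁₃ ht₃.2 him₂ rfl hΦ.symm
    have hmem : (γ t₁ : EuclideanSpace ℝ (Fin 2)) ∈ segment ℝ (γ t₂ : EuclideanSpace ℝ (Fin 2))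
        (γ t₃) := heq ▸ ⟨t₁, ⟨h.le, h₁₃.le⟩, rfl⟩
    exact absurd ((hbtw.wbtw.swap_left_iff).1 (mem_segment_iff_wbtw.1 hmem)) hbtw.left_ne
  · exact absurd (congrArg (fun t => (γ t : EuclideanSpace ℝ (Fin 2))) h) hbtw.ne_left
  rcases lt_trichotomy t₂ t₃ with h' | h' | h'
  · exact straight t₁ t₂ t₃ ht₁.1 h h' ht₃.2 rfl him₂ hΦ.symm
  · exact absurd (congrArg (fun t => (γ t : EuclideanSpace ℝ (Fin 2))) h') hbtw.ne_right
  · have heq := straight t₁ t₃ t₂ ht₁.1 h₁₃ h' ht₂.2 rfl hΦ.symm him₂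
    have hmem : (γ t₃ : EuclideanSpace ℝ (Fin 2)) ∈ segment ℝ (γ t₁ : EuclideanSpace ℝ (Fin 2))
        (γ t₂) := heq ▸ ⟨t₃, ⟨h₁₃.le, h'.le⟩, rfl⟩
    exact absurd ((hbtw.wbtw.swap_right_iff).1 (mem_segment_iff_wbtw.1 hmem)) hbtw.ne_right

end IsGeodesicSegment

namespace SimpleGeodesicTriangle

/-- Every edge of a simple geodesic triangle can be labelled as its first edge. -/
theorem exists_relabel {M : Type*} [MetricSpace M] {E : Set M} (T : SimpleGeodesicTriangle E)
    {γ : ℝ → E} {L : ℝ}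
    (hA : (γ = T.σ ∧ L = T.a) ∨ (γ = T.τ ∧ L = T.b) ∨ (γ = T.ρ ∧ L = T.c)) :
    ∃ T' : SimpleGeodesicTriangle E, T'.σ = γ ∧ T'.a = L := by
  have rev : ∀ (δ : ℝ → E) (d : ℝ), (Subtype.val ∘ fun t => δ (d - t)) '' Icc 0 d =
      (Subtype.val ∘ δ) '' Icc 0 d := fun δ d => image_comp_sub_Icc (Subtype.val ∘ δ) d
  rcases hA with ⟨rfl, rfl⟩ | ⟨rfl, rfl⟩ | ⟨rfl, rfl⟩
  · exact ⟨T, rfl, rfl⟩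
  · refine ⟨⟨T.p, T.r, T.q, T.τ, T.σ, fun t => T.ρ (T.c - t), T.b, T.a, T.c, T.hb, T.ha, T.hc,
      T.hτ, T.hσ, T.hρ.reverse, ?_⟩, rfl, rfl⟩
    rw [rev, union_comm (_ '' Icc 0 T.b)]
    exact T.simple
  · refine ⟨⟨T.q, T.r, T.p, T.ρ, fun t => T.σ (T.a - t), fun t => T.τ (T.b - t), T.c, T.a, T.b,
      T.hc, T.ha, T.hb, T.hρ, T.hσ.reverse, T.hτ.reverse, ?_⟩, rfl, rfl⟩
    rw [rev, rev, union_assoc, union_comm]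
    exact T.simple

end SimpleGeodesicTriangle

/-- If `p₁`, `p₂`, `p₃` are three distinct collinear points on a single
edge `A` of a simple geodesic triangle `T`, with `p₂` between `p₁` and `p₃`, and the
open segments `p₁p₂` and `p₂p₃` are disjoint from `T \ A`, then the arc of `T` from
`p₁` to `p₃` along `A` is exactly the straight segment from `p₁` to `p₃`. -/
theorem arc_follows_line (E : Set (EuclideanSpace ℝ (Fin 2)))
    (hclosed : IsClosed E) (hsc : SimplyConnectedSpace E)
    (hrect : ∀ x y : E, pathEDist x y ≠ ⊤)
    (T : SimpleGeodesicTriangle E) (γ : ℝ → E) (L : ℝ)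
    (hA : (γ = T.σ ∧ L = T.a) ∨ (γ = T.τ ∧ L = T.b) ∨ (γ = T.ρ ∧ L = T.c))
    (t₁ t₂ t₃ : ℝ) (h₁ : t₁ ∈ Set.Icc 0 L) (h₂ : t₂ ∈ Set.Icc 0 L) (h₃ : t₃ ∈ Set.Icc 0 L)
    (hne₁₂ : (γ t₁ : EuclideanSpace ℝ (Fin 2)) ≠ γ t₂)
    (hne₂₃ : (γ t₂ : EuclideanSpace ℝ (Fin 2)) ≠ γ t₃)
    (hne₁₃ : (γ t₁ : EuclideanSpace ℝ (Fin 2)) ≠ γ t₃)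
    (hbetween : (γ t₂ : EuclideanSpace ℝ (Fin 2)) ∈
      openSegment ℝ (γ t₁ : EuclideanSpace ℝ (Fin 2)) (γ t₃ : EuclideanSpace ℝ (Fin 2)))
    (hmiss₁ : openSegment ℝ (γ t₁ : EuclideanSpace ℝ (Fin 2)) (γ t₂ : EuclideanSpace ℝ (Fin 2)) ∩
      (T.im \ (Subtype.val ∘ γ) '' Set.Icc 0 L) = ∅)
    (hmiss₂ : openSegment ℝ (γ t₂ : EuclideanSpace ℝ (Fin 2)) (γ t₃ : EuclideanSpace ℝ (Fin 2)) ∩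
      (T.im \ (Subtype.val ∘ γ) '' Set.Icc 0 L) = ∅) :
    (Subtype.val ∘ γ) '' Set.Icc (min t₁ t₃) (max t₁ t₃) =
      segment ℝ (γ t₁ : EuclideanSpace ℝ (Fin 2)) (γ t₃ : EuclideanSpace ℝ (Fin 2)) := by
  have hbtw : Sbtw ℝ (γ t₁ : EuclideanSpace ℝ (Fin 2)) (γ t₂) (γ t₃) :=
    ⟨mem_segment_iff_wbtw.1 (openSegment_subset_segment ℝ _ _ hbetween), hne₁₂.symm, hne₂₃⟩
  obtain ⟨T', rfl, rfl⟩ := T.exists_relabel hA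
  rcases lt_trichotomy t₁ t₃ with h | h | h
  · rw [min_eq_left h.le, max_eq_right h.le]
    exact T'.hσ.image_Icc_eq_segment_of_triangle hsc T'.hτ T'.hρ T'.hb T'.hc T'.simple h₁ h₂ h₃ h
      hbtw
  · exact absurd (by rw [h]) hne₁₃
  · rw [min_eq_right h.le, max_eq_left h.le, segment_symm]
    exact T'.hσ.image_Icc_eq_segment_of_triangle hsc T'.hτ T'.hρ T'.hb T'.hc T'.simple h₃ h₂ h₁ h
      hbtw.symm
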